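/- arXiv:2102.02487 — 9 statements merged into one kernel-verified Lean document; each statement's English description precedes it below -/
import Mathlib

section
/- For every real ε with 0 < ε < 1 there exists n₀ such that for every integer n > n₀ and every integer m with n ≤ m ≤ n^{1/ε}, there exists a hypergraph H on n vertices with m hyperedges such that s(H) ≥ m^{2-ε}; that is, H admits no sum-distinguishing labeling whose labels are all at most m^{2-ε}. -/
/-- A labeling of the vertices of a hypergraph with hyperedge set `E` by positive integers is
sum-distinguishing if distinct hyperedges receive distinct sums of labels. -/
def SumDistinguishing {V : Type*} (E : Finset (Finset V)) (f : V → ℕ) : Prop :=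
  (∀ v, 1 ≤ f v) ∧ ∀ e ∈ E, ∀ e' ∈ E, e ≠ e' → ∑ v ∈ e, f v ≠ ∑ v ∈ e', f v

section

open Finset

/-- Weak Stirling bound. -/
lemma factorial_mul_exp_le (m : ℕ) (hm : 1 ≤ m) :
    (m.factorial : ℝ) * Real.exp m ≤ Real.exp 1 * m * (m : ℝ) ^ m := by
  induction m, hm using Nat.le_induction with
  | base => simp
  | succ m hm ih =>
    have hm0 : (0 : ℝ) < m := by exact_mod_cast hm
    have key : Real.exp 1 * (m : ℝ) ^ (m + 1) ≤ ((m : ℝ) + 1) ^ (m + 1) := by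
      have h1 := Real.one_sub_inv_le_log_of_pos (x := ((m : ℝ) + 1) / m) (by positivity)
      have h2 : 1 ≤ ((m : ℝ) + 1) * Real.log (((m : ℝ) + 1) / m) := by
        have h3 : 1 - (((m : ℝ) + 1) / m)⁻¹ = 1 / ((m : ℝ) + 1) := by
          field_simp
          ring
        rw [h3, div_le_iff₀ (by positivity)] at h1
        linarith
      have h4 : Real.exp 1 ≤ (((m : ℝ) + 1) / m) ^ (m + 1) := by
        rw [← Real.le_log_iff_exp_le (by positivity), Real.log_pow]
        exact_mod_cast h2
      rw [div_pow, le_div_iff₀ (by positivity)] at h4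
      exact h4
    rw [Nat.factorial_succ]
    push_cast
    rw [Real.exp_add]
    calc ((m : ℝ) + 1) * m.factorial * (Real.exp m * Real.exp 1)
        = ((m : ℝ) + 1) * Real.exp 1 * (m.factorial * Real.exp m) := by ring
      _ ≤ ((m : ℝ) + 1) * Real.exp 1 * (Real.exp 1 * m * (m : ℝ) ^ m) := by gcongr
      _ = Real.exp 1 * ((m : ℝ) + 1) * (Real.exp 1 * (m : ℝ) ^ (m + 1)) := by ring
      _ ≤ Real.exp 1 * ((m : ℝ) + 1) * ((m : ℝ) + 1) ^ (m + 1) := by gcongr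

open Classical in
/-- Subsets of `U` on which `c` is injective with image `T` number at most the product over `T`
of the sizes of the fibres of `c`. -/
lemma card_injOn_image_eq_le {α β : Type*} [DecidableEq β]
    (U : Finset α) (c : α → β) (T : Finset β) :
    #(U.powerset.filter fun E : Finset α => Set.InjOn c E ∧ E.image c = T) ≤ ∏ i ∈ T, #{x ∈ U | c x = i} := by
  classical
  rw [← Finset.card_pi]
  refine Finset.card_le_card_of_surjOn
    (fun p : (i : β) → i ∈ T → α => T.attach.image fun i => p i.1 i.2) ?_
  intro E hE
  simp only [coe_filter, mem_powerset, Set.mem_ofPred_eq] at hE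
  obtain ⟨hEU, hinj, rfl⟩ := hE
  have hex : ∀ i ∈ E.image c, ∃ x ∈ E, c x = i := fun i hi => by simpa using hi
  choose p hpE hpc using hex
  refine ⟨p, ?_, ?_⟩
  · simp only [mem_coe, mem_pi, mem_filter]
    exact fun i hi => ⟨hEU (hpE i hi), hpc i hi⟩
  · ext x
    simp only [mem_image, mem_attach, true_and, Subtype.exists]
    constructor
    · rintro ⟨i, hi, rfl⟩
      exact hpE i (by simpa using hi)
    · intro hx
      exact ⟨c x, ⟨x, hx, rfl⟩, hinj (hpE _ (mem_image_of_mem c hx)) hx (hpc _ _)⟩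

open Classical in
lemma card_injOn_mul_pow_le {α : Type*} (U : Finset α) (c : α → ℕ) (S m : ℕ)
    (hc : ∀ x ∈ U, c x < S) (z : ℝ) (hz : 0 ≤ z) :
    (#((U.powersetCard m).filter fun E : Finset α => Set.InjOn c E) : ℝ) * z ^ m
      ≤ ∏ i ∈ range S, (1 + z * #{x ∈ U | c x = i}) := by
  classical
  have h1 : #((U.powersetCard m).filter fun E : Finset α => Set.InjOn c E)
      ≤ ∑ T ∈ (range S).powersetCard m, ∏ i ∈ T, #{x ∈ U | c x = i} := by
    rw [Finset.card_eq_sum_card_fiberwise (f := fun E => E.image c)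
      (t := (range S).powersetCard m)]
    · refine Finset.sum_le_sum fun T _ => le_trans (card_le_card ?_)
        (card_injOn_image_eq_le U c T)
      intro E hE
      simp only [mem_filter, mem_powersetCard, mem_powerset] at hE ⊢
      exact ⟨hE.1.1.1, hE.1.2, hE.2⟩
    · intro E hE
      simp only [coe_filter, mem_powersetCard, Set.mem_ofPred_eq, mem_coe] at hE ⊢
      refine ⟨?_, by rw [card_image_of_injOn hE.2, hE.1.2]⟩
      intro i hi
      obtain ⟨x, hx, rfl⟩ := mem_image.1 hi
      exact mem_range.2 (hc x (hE.1.1 hx))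
  calc (#((U.powersetCard m).filter fun E : Finset α => Set.InjOn c E) : ℝ) * z ^ m
      ≤ (∑ T ∈ (range S).powersetCard m, ∏ i ∈ T, (#{x ∈ U | c x = i} : ℝ)) * z ^ m := by
        gcongr
        exact_mod_cast h1
    _ = ∑ T ∈ (range S).powersetCard m, ∏ i ∈ T, (z * #{x ∈ U | c x = i}) := by
        rw [Finset.sum_mul]
        refine Finset.sum_congr rfl fun T hT => ?_
        rw [Finset.prod_mul_distrib, Finset.prod_const, (mem_powersetCard.1 hT).2, mul_comm]
    _ ≤ ∑ T ∈ (range S).powerset, ∏ i ∈ T, (z * #{x ∈ U | c x = i}) := by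
        refine Finset.sum_le_sum_of_subset_of_nonneg ?_ fun T _ _ =>
          Finset.prod_nonneg fun i _ => by positivity
        intro T hT
        exact mem_powerset.2 (mem_powersetCard.1 hT).1
    _ = _ := (Finset.prod_one_add _).symm

lemma prod_one_add_le_pow {ι : Type*} (s : Finset ι) (a : ι → ℝ) (ha : ∀ i ∈ s, 0 ≤ a i)
    (y : ℝ) (hy : 0 ≤ y) (hsum : ∑ i ∈ s, a i = #s * y) :
    ∏ i ∈ s, (1 + a i) ≤ (1 + y) ^ #s := by
  have hle : ∀ i ∈ s, 1 + a i ≤ (1 + y) * Real.exp ((a i - y) / (1 + y)) := by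
    intro i _
    have h := Real.add_one_le_exp ((a i - y) / (1 + y))
    calc 1 + a i = (1 + y) * ((a i - y) / (1 + y) + 1) := by field_simp; ring
      _ ≤ _ := by gcongr
  refine (Finset.prod_le_prod (fun i hi => by linarith [ha i hi]) hle).trans (le_of_eq ?_)
  rw [Finset.prod_mul_distrib, Finset.prod_const, ← Real.exp_sum, ← Finset.sum_div,
    Finset.sum_sub_distrib, hsum]
  simp

lemma one_add_le_exp_sub_sq {y : ℝ} (hy0 : 0 ≤ y) (hy1 : y ≤ 1) :
    1 + y ≤ Real.exp (y - y ^ 2 / 4) := by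
  have h := Real.quadratic_le_exp_of_nonneg (x := y - y ^ 2 / 4) (by nlinarith)
  have h2 : (1 / 2 : ℝ) ≤ (1 - y / 4) ^ 2 := by nlinarith
  have h3 : (y - y ^ 2 / 4) ^ 2 = y ^ 2 * (1 - y / 4) ^ 2 := by ring
  nlinarith [mul_le_mul_of_nonneg_left h2 (sq_nonneg y)]

open Classical in
/-- Birthday bound: a map with at most `S` values is injective on few `m`-subsets. -/
lemma card_injOn_le {α : Type*} (U : Finset α) (c : α → ℕ) (S m : ℕ)
    (hc : ∀ x ∈ U, c x < S) (hm : 1 ≤ m) (hmS : m ≤ S) (hU : 1 ≤ #U) :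
    (#((U.powersetCard m).filter fun E : Finset α => Set.InjOn c E) : ℝ)
      ≤ ((#U : ℝ) / m) ^ m * Real.exp (m - (m : ℝ) ^ 2 / (4 * S)) := by
  have hm0 : (0 : ℝ) < m := by exact_mod_cast hm
  have hS0 : (0 : ℝ) < S := by exact_mod_cast hm.trans hmS
  have hU0 : (0 : ℝ) < #U := by exact_mod_cast hU
  have hy1 : (m : ℝ) / S ≤ 1 := by
    rw [div_le_one hS0]
    exact_mod_cast hmS
  have hcard : ∑ i ∈ range S, (#{x ∈ U | c x = i} : ℝ) = #U := by
    rw [Finset.card_eq_sum_card_fiberwise (f := c) (s := U) (t := range S)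
      fun x hx => by simpa using hc x hx]
    push_cast
    rfl
  have h1 := card_injOn_mul_pow_le U c S m hc (m / #U) (by positivity)
  have h2 := prod_one_add_le_pow (range S) (fun i => (m : ℝ) / #U * #{x ∈ U | c x = i})
    (fun i _ => by positivity) (m / S) (by positivity) (by
      rw [← Finset.mul_sum, hcard, card_range]
      field_simp)
  have h3 : (1 + (m : ℝ) / S) ^ S ≤ Real.exp (m - (m : ℝ) ^ 2 / (4 * S)) := by
    calc (1 + (m : ℝ) / S) ^ S ≤ Real.exp (m / S - (m / S) ^ 2 / 4) ^ S := by
          gcongr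
          exact one_add_le_exp_sub_sq (by positivity) hy1
      _ = Real.exp (m - (m : ℝ) ^ 2 / (4 * S)) := by
          rw [← Real.exp_nat_mul]
          congr 1
          field_simp
  rw [card_range] at h2
  have h4 := (h1.trans h2).trans h3
  rw [← le_div_iff₀ (by positivity)] at h4
  refine h4.trans (le_of_eq ?_)
  rw [div_eq_mul_inv, ← inv_pow, inv_div, mul_comm]

lemma pow_le_two_mul_factorial_mul_choose (M m : ℕ) (hM : 1 ≤ M) (h : 2 * m ^ 2 ≤ M) :
    (M : ℝ) ^ m ≤ 2 * m.factorial * M.choose m := by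
  have hM0 : (0 : ℝ) < M := by exact_mod_cast hM
  have hh : 2 * (m : ℝ) ^ 2 ≤ M := by exact_mod_cast h
  have hmM : m ≤ M := by nlinarith [Nat.zero_le m, sq_nonneg ((m : ℤ) - 1)]
  have hmM' : (m : ℝ) ≤ M := by exact_mod_cast hmM
  have h1 : ((M : ℝ) - m) ^ m ≤ m.factorial * M.choose m := by
    have := Nat.pow_sub_le_descFactorial M m
    rw [Nat.descFactorial_eq_factorial_mul_choose] at this
    have h2 : (((M + 1 - m) ^ m : ℕ) : ℝ) ≤ m.factorial * M.choose m := by exact_mod_cast this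
    refine le_trans ?_ h2
    rw [Nat.cast_pow, Nat.cast_sub (by omega)]
    push_cast
    gcongr
    · linarith
  have h2 : (1 / 2 : ℝ) ≤ (1 + -(m / M : ℝ)) ^ m := by
    have hb := one_add_mul_le_pow (a := -(m / M : ℝ))
      (by have : (m : ℝ) / M ≤ 1 := by rw [div_le_one hM0]; exact hmM'
          linarith) m
    refine le_trans ?_ hb
    have : (m : ℝ) * (m / M) ≤ 1 / 2 := by
      rw [← mul_div_assoc, div_le_iff₀ hM0]
      nlinarith
    linarith
  have h3 : ((M : ℝ) - m) ^ m = (M : ℝ) ^ m * (1 + -(m / M : ℝ)) ^ m := by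
    rw [← mul_pow]
    congr 1
    field_simp
    ring
  have h4 : (M : ℝ) ^ m * (1 / 2) ≤ (M : ℝ) ^ m * (1 + -(m / M : ℝ)) ^ m := by gcongr
  linarith

/-- Union bound over all labelings of `k` vertices with labels in `[1, N]`. -/
lemma exists_hypergraph_of_lt_exp (k N m : ℕ) (hm : 1 ≤ m) (hmS : m ≤ k * N + 1)
    (hM : 2 * m ^ 2 ≤ 2 ^ k)
    (hlt : 2 * Real.exp 1 * m * (N : ℝ) ^ k
      < Real.exp ((m : ℝ) ^ 2 / (4 * (k * N + 1 : ℕ)))) :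
    ∃ E : Finset (Finset (Fin k)), #E = m ∧ ∀ f : Fin k → ℕ, (∀ v, 1 ≤ f v ∧ f v ≤ N) →
      ¬ Set.InjOn (fun e => ∑ v ∈ e, f v) (E : Set (Finset (Fin k))) := by
  classical
  set S := k * N + 1 with hS
  set M := 2 ^ k with hMdef
  set F : Finset (Fin k → ℕ) := Fintype.piFinset fun _ => Icc 1 N with hF
  set U : Finset (Finset (Fin k)) := univ with hUdef
  have hU : #U = M := by simp [hUdef, hMdef]
  have hM1 : 1 ≤ M := Nat.one_le_two_pow
  have hm0 : (0 : ℝ) < m := by exact_mod_cast hm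
  have hMpos : (0 : ℝ) < M := by exact_mod_cast hM1
  have hFc : #F = N ^ k := by simp [hF]
  let bad : (Fin k → ℕ) → Finset (Finset (Finset (Fin k))) := fun f =>
    {E ∈ U.powersetCard m | Set.InjOn (fun e => ∑ v ∈ e, f v) (E : Set (Finset (Fin k)))}
  have hbad : ∀ f ∈ F, (#(bad f) : ℝ)
      ≤ ((M : ℝ) / m) ^ m * Real.exp (m - (m : ℝ) ^ 2 / (4 * S)) := by
    intro f hf
    rw [← hU]
    refine card_injOn_le U _ S m ?_ hm hmS (hU ▸ hM1)
    intro e _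
    have hf' : ∀ v, f v ≤ N := fun v => (mem_Icc.1 (Fintype.mem_piFinset.1 hf v)).2
    have h1 : ∑ v ∈ e, f v ≤ #e * N := Finset.sum_le_card_nsmul _ _ _ fun v _ => hf' v
    have h2 : #e ≤ k := by simpa using card_le_univ e
    exact Nat.lt_succ_of_le (h1.trans (Nat.mul_le_mul_right N h2))
  have hcount : #(F.biUnion bad) < #(U.powersetCard m) := by
    have h1 : (#(F.biUnion bad) : ℝ)
        ≤ (N : ℝ) ^ k * (((M : ℝ) / m) ^ m * Real.exp (m - (m : ℝ) ^ 2 / (4 * S))) := by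
      calc (#(F.biUnion bad) : ℝ) ≤ ∑ f ∈ F, (#(bad f) : ℝ) := by
            exact_mod_cast card_biUnion_le
        _ ≤ #F • _ := Finset.sum_le_card_nsmul _ _ _ hbad
        _ = _ := by rw [hFc, nsmul_eq_mul]; push_cast; rfl
    have h2 := pow_le_two_mul_factorial_mul_choose M m hM1 hM
    have h3 := factorial_mul_exp_le m hm
    rw [card_powersetCard, hU]
    have h4 : (N : ℝ) ^ k * (((M : ℝ) / m) ^ m * Real.exp (m - (m : ℝ) ^ 2 / (4 * S)))
        < M.choose m := by
      rw [Real.exp_sub, div_pow]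
      set X := Real.exp ((m : ℝ) ^ 2 / (4 * S))
      have hX0 : 0 < X := Real.exp_pos _
      have hc : (0 : ℝ) < M.choose m := by
        have : (0 : ℝ) < M ^ m := by positivity
        have h5 := this.trans_le h2
        exact pos_of_mul_pos_right h5 (by positivity)
      rw [show (N : ℝ) ^ k * ((M : ℝ) ^ m / (m : ℝ) ^ m * (Real.exp m / X))
        = (N : ℝ) ^ k * ((M : ℝ) ^ m * Real.exp m) / ((m : ℝ) ^ m * X) by field_simp,
        div_lt_iff₀ (by positivity)]
      calc (N : ℝ) ^ k * ((M : ℝ) ^ m * Real.exp m)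
          ≤ (N : ℝ) ^ k * ((2 * m.factorial * M.choose m) * Real.exp m) := by gcongr
        _ = (N : ℝ) ^ k * 2 * M.choose m * (m.factorial * Real.exp m) := by ring
        _ ≤ (N : ℝ) ^ k * 2 * M.choose m * (Real.exp 1 * m * (m : ℝ) ^ m) := by gcongr
        _ = M.choose m * (m : ℝ) ^ m * (2 * Real.exp 1 * m * (N : ℝ) ^ k) := by ring
        _ < M.choose m * (m : ℝ) ^ m * X := by gcongr
        _ = _ := by ring
    exact_mod_cast h1.trans_lt h4
  obtain ⟨E, hE, hEbad⟩ := Finset.exists_mem_notMem_of_card_lt_card hcount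
  refine ⟨E, (mem_powersetCard.1 hE).2, fun f hf hinj => hEbad ?_⟩
  refine mem_biUnion.2 ⟨f, ?_, mem_filter.2 ⟨hE, hinj⟩⟩
  exact Fintype.mem_piFinset.2 fun v => mem_Icc.2 (hf v)

lemma eventually_log_pow_three_le (ε : ℝ) (hε : 0 < ε) :
    ∃ n₀ : ℕ, ∀ m : ℕ, n₀ < m →
      1 ≤ Real.log m ∧ 1000 * Real.log m ^ 3 ≤ (m : ℝ) ^ ε := by
  have h1 := (isLittleO_log_rpow_rpow_atTop 3 hε).bound (c := 1 / 1000) (by norm_num)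
  have h2 := Real.tendsto_log_atTop.eventually_ge_atTop 1
  have h3 := tendsto_natCast_atTop_atTop (R := ℝ) |>.eventually (h1.and h2)
  obtain ⟨n₀, hn₀⟩ := Filter.eventually_atTop.1 h3
  refine ⟨n₀, fun m hm => ?_⟩
  obtain ⟨ha, hb⟩ := hn₀ m hm.le
  refine ⟨hb, ?_⟩
  have hb0 : 0 ≤ Real.log m := by linarith
  rw [Real.norm_of_nonneg (by positivity), Real.norm_of_nonneg (by positivity)] at ha
  rw [show Real.log m ^ (3 : ℝ) = Real.log m ^ 3 by norm_cast] at ha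
  linarith

lemma exists_hypergraph_of_log_pow_three_le (ε : ℝ) (hε0 : 0 < ε) (hε1 : ε < 1) (m : ℕ)
    (hL : 1 ≤ Real.log m) (hLm : 1000 * Real.log m ^ 3 ≤ (m : ℝ) ^ ε) :
    ∃ k : ℕ, (k : ℝ) ≤ (m : ℝ) ^ ε ∧ ∃ E : Finset (Finset (Fin k)), #E = m ∧
      ∀ f : Fin k → ℕ, (∀ v, 1 ≤ f v ∧ (f v : ℝ) ≤ (m : ℝ) ^ (2 - ε)) →
        ¬ Set.InjOn (fun e => ∑ v ∈ e, f v) (E : Set (Finset (Fin k))) := by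
  set L := Real.log m with hLdef
  have hm : 1 ≤ m := by
    rcases Nat.eq_zero_or_pos m with rfl | h
    · simp at hLdef
      linarith
    · exact h
  have hm0 : (0 : ℝ) < m := by exact_mod_cast hm
  have hm1 : (1 : ℝ) ≤ m := by exact_mod_cast hm
  have hmL : (m : ℝ) = Real.exp L := (Real.exp_log hm0).symm
  set P := (m : ℝ) ^ (2 - ε) with hP
  have hP0 : 0 < P := by positivity
  have hPm : (m : ℝ) ≤ P := by
    calc (m : ℝ) = (m : ℝ) ^ (1 : ℝ) := (Real.rpow_one _).symm
      _ ≤ P := Real.rpow_le_rpow_of_exponent_le hm1 (by linarith)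
  have hPle : P ≤ (m : ℝ) ^ 2 := by
    calc P ≤ (m : ℝ) ^ (2 : ℝ) := Real.rpow_le_rpow_of_exponent_le hm1 (by linarith)
      _ = (m : ℝ) ^ 2 := by norm_cast
  have hPmul : P * (m : ℝ) ^ ε = (m : ℝ) ^ 2 := by
    rw [hP, ← Real.rpow_add hm0, sub_add_cancel]
    norm_cast
  set N := ⌊P⌋₊ with hN
  have hNP : (N : ℝ) ≤ P := Nat.floor_le hP0.le
  have hmN : m ≤ N := Nat.le_floor hPm
  set k := ⌈6 * L⌉₊ with hk
  have hk6 : 6 * L ≤ k := Nat.le_ceil _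
  have hk7 : (k : ℝ) ≤ 7 * L := by
    have := Nat.ceil_lt_add_one (a := 6 * L) (by linarith)
    linarith
  have hk1 : 1 ≤ k := by
    have : (0 : ℝ) < k := by linarith
    exact_mod_cast this
  have hL3 : L ≤ L ^ 3 := by nlinarith [mul_nonneg (sub_nonneg.2 hL) (by positivity : 0 ≤ L)]
  refine ⟨k, by linarith, ?_⟩
  have hmain := exists_hypergraph_of_lt_exp k N m hm ?_ ?_ ?_
  · obtain ⟨E, hE, h⟩ := hmain
    exact ⟨E, hE, fun f hf => h f fun v => ⟨(hf v).1, Nat.le_floor (hf v).2⟩⟩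
  · nlinarith
  · have h2 : 2 * (m : ℝ) ^ 2 ≤ 2 ^ k := by
      have hlog2 := Real.log_two_gt_d9
      have h2e : (2 : ℝ) ≤ Real.exp L := by linarith [Real.add_one_le_exp L]
      calc 2 * (m : ℝ) ^ 2 ≤ Real.exp L * Real.exp L ^ 2 := by
            rw [← hmL] at h2e ⊢
            gcongr
        _ = Real.exp (3 * L) := by rw [← pow_succ', ← Real.exp_nat_mul]; norm_num
        _ ≤ Real.exp (k * Real.log 2) := by
            refine Real.exp_le_exp.2 ?_
            nlinarith
        _ = 2 ^ k := by rw [Real.exp_nat_mul, Real.exp_log (by norm_num)]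
    exact_mod_cast h2
  · have hN0 : (0 : ℝ) < N := by exact_mod_cast hm.trans hmN
    have hlogN : Real.log N ≤ 2 * L := by
      calc Real.log N ≤ Real.log ((m : ℝ) ^ 2) := Real.log_le_log hN0 (hNP.trans hPle)
        _ = 2 * L := by rw [Real.log_pow]; norm_num [hLdef]
    have hNk : (N : ℝ) ^ k ≤ Real.exp (14 * L ^ 2) := by
      calc (N : ℝ) ^ k = Real.exp (k * Real.log N) := by
            rw [Real.exp_nat_mul, Real.exp_log hN0]
        _ ≤ Real.exp (14 * L ^ 2) := by
            refine Real.exp_le_exp.2 ?_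
            calc (k : ℝ) * Real.log N ≤ (7 * L) * (2 * L) := by
                  gcongr
              _ = 14 * L ^ 2 := by ring
    have h2e : (2 : ℝ) ≤ Real.exp 1 := by linarith [Real.add_one_le_exp (1 : ℝ)]
    have hleft : 2 * Real.exp 1 * m * (N : ℝ) ^ k ≤ Real.exp (17 * L ^ 2) := by
      calc 2 * Real.exp 1 * m * (N : ℝ) ^ k
          ≤ Real.exp 1 * Real.exp 1 * Real.exp L * Real.exp (14 * L ^ 2) := by
            rw [← hmL]
            gcongr
        _ = Real.exp (1 + 1 + L + 14 * L ^ 2) := by simp only [Real.exp_add]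
        _ ≤ Real.exp (17 * L ^ 2) := by
            refine Real.exp_le_exp.2 ?_
            nlinarith
    refine hleft.trans_lt (Real.exp_lt_exp.2 ?_)
    have hS : ((k * N + 1 : ℕ) : ℝ) ≤ 14 * L * P := by
      have h1 : ((k * N + 1 : ℕ) : ℝ) ≤ 2 * (k * N) := by
        have : 1 ≤ k * N := Nat.mul_pos hk1 (by omega)
        have : k * N + 1 ≤ 2 * (k * N) := by omega
        exact_mod_cast this
      have h2 : (k : ℝ) * N ≤ 7 * L * P := by gcongr
      linarith
    have hS0 : (0 : ℝ) < ((k * N + 1 : ℕ) : ℝ) := by positivity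
    rw [lt_div_iff₀ (by positivity), ← hPmul]
    calc 17 * L ^ 2 * (4 * ((k * N + 1 : ℕ) : ℝ)) ≤ 17 * L ^ 2 * (4 * (14 * L * P)) := by gcongr
      _ = P * (952 * L ^ 3) := by ring
      _ < P * (1000 * L ^ 3) := by gcongr; norm_num
      _ ≤ P * (m : ℝ) ^ ε := by gcongr

end

/-- For every real `ε` with `0 < ε < 1` there exists `n₀` such that for every `n > n₀` and every
`m` with `n ≤ m ≤ n^(1/ε)`, there is a hypergraph on `n` vertices with `m` hyperedges admitting
no sum-distinguishing labeling whose labels are all at most `m^(2-ε)`. -/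
theorem stmt0 (ε : ℝ) (hε0 : 0 < ε) (hε1 : ε < 1) :
    ∃ n₀ : ℕ, ∀ n : ℕ, n₀ < n → ∀ m : ℕ, n ≤ m → (m : ℝ) ≤ (n : ℝ) ^ (1 / ε) →
      ∃ E : Finset (Finset (Fin n)), E.card = m ∧
        ¬ ∃ f : Fin n → ℕ, SumDistinguishing E f ∧ ∀ v, (f v : ℝ) ≤ (m : ℝ) ^ (2 - ε) := by
  obtain ⟨n₀, hn₀⟩ := eventually_log_pow_three_le ε hε0
  refine ⟨n₀, fun n hn m hnm hmn => ?_⟩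
  obtain ⟨hL, hLm⟩ := hn₀ m (hn.trans_le hnm)
  obtain ⟨k, hk, E, hE, h⟩ := exists_hypergraph_of_log_pow_three_le ε hε0 hε1 m hL hLm
  have hkn : k ≤ n := by
    have h1 : (m : ℝ) ^ ε ≤ n := by
      calc (m : ℝ) ^ ε ≤ ((n : ℝ) ^ (1 / ε)) ^ ε := by gcongr
        _ = n := by rw [← Real.rpow_mul (by positivity), one_div_mul_cancel hε0.ne', Real.rpow_one]
    exact_mod_cast hk.trans h1
  let ι := Finset.mapEmbedding (Fin.castLEEmb hkn)
  refine ⟨E.map ι.toEmbedding, by rw [Finset.card_map, hE], ?_⟩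
  rintro ⟨f, ⟨hf1, hfE⟩, hfP⟩
  refine h (fun v => f (Fin.castLE hkn v)) (fun v => ⟨hf1 _, hfP _⟩) ?_
  intro e he e' he' hee
  by_contra hne
  refine hfE (ι e) (Finset.mem_map_of_mem _ he) (ι e') (Finset.mem_map_of_mem _ he')
    (fun heq => hne (ι.injective heq)) ?_
  simpa [ι] using hee
end

section
/- For every real C > 0 there exists n₀ such that for every integer n > n₀ and every integer m ≥ n, every hypergraph H on n vertices with m hyperedges satisfies s(H) ≤ m²/C; that is, H admits a sum-distinguishing labeling whose labels are all at most ⌈m²/C⌉. -/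
open Finset Function

theorem succ_mul_centralBinom_sq_le (r : ℕ) :
    (2 * r + 1) * r.centralBinom ^ 2 ≤ 4 ^ (2 * r) := by
  induction r with
  | zero => simp
  | succ r ih =>
    have h := Nat.succ_mul_centralBinom_succ r
    have hpow : 4 ^ (2 * (r + 1)) = 16 * 4 ^ (2 * r) := by
      rw [mul_add, pow_add]; ring
    rw [hpow]
    refine Nat.le_of_mul_le_mul_left ?_ (pow_pos r.succ_pos 2)
    calc (r + 1) ^ 2 * ((2 * (r + 1) + 1) * (r + 1).centralBinom ^ 2)
        = (2 * r + 3) * ((r + 1) * (r + 1).centralBinom) ^ 2 := by ring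
      _ = 4 * ((2 * r + 3) * (2 * r + 1)) * ((2 * r + 1) * r.centralBinom ^ 2) := by rw [h]; ring
      _ ≤ 4 * (4 * (r + 1) ^ 2) * 4 ^ (2 * r) := by
          refine Nat.mul_le_mul (Nat.mul_le_mul_left 4 ?_) ih
          nlinarith
      _ = (r + 1) ^ 2 * (16 * 4 ^ (2 * r)) := by ring

theorem mul_choose_sq_le (k s : ℕ) : k * k.choose s ^ 2 ≤ 4 ^ k := by
  have even (r t : ℕ) : (2 * r + 1) * (2 * r).choose t ^ 2 ≤ 4 ^ (2 * r) :=
    (Nat.mul_le_mul_left _ (Nat.pow_le_pow_left (Nat.choose_le_centralBinom t r) 2)).trans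
      (succ_mul_centralBinom_sq_le r)
  obtain ⟨r, rfl | rfl⟩ := Nat.even_or_odd' k
  · exact (Nat.mul_le_mul_right _ (Nat.le_succ _)).trans (even r s)
  · have hle : (2 * r + 1).choose s ≤ 2 * r.centralBinom := by
      cases s with
      | zero => have := r.centralBinom_pos; rw [Nat.choose_zero_right]; omega
      | succ s =>
        rw [Nat.choose_succ_succ, two_mul (r.centralBinom)]
        exact Nat.add_le_add (Nat.choose_le_centralBinom _ _) (Nat.choose_le_centralBinom _ _)
    calc (2 * r + 1) * (2 * r + 1).choose s ^ 2
        ≤ (2 * r + 1) * (2 * r.centralBinom) ^ 2 := by gcongr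
      _ = 4 * ((2 * r + 1) * r.centralBinom ^ 2) := by ring
      _ ≤ 4 * 4 ^ (2 * r) := Nat.mul_le_mul_left 4 (succ_mul_centralBinom_sq_le r)
      _ = 4 ^ (2 * r + 1) := by ring

section Collision

variable {V A R : Type*}

/-- The hyperedges `e` and `e'` receive the same sum under `f`, read through `lab`. -/
def Collides [AddCommMonoid R] (lab : A → R) (e e' : Finset V) (f : V → A) : Prop :=
  ∑ v ∈ e, lab (f v) = ∑ v ∈ e', lab (f v)

variable [AddCancelCommMonoid R] {lab : A → R} {e e' : Finset V} {f g : V → A} {a : V}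

theorem Collides.symm (h : Collides lab e e' f) : Collides lab e' e f := Eq.symm h

variable [DecidableEq V]

theorem collides_iff_sdiff :
    Collides lab e e' f ↔ ∑ v ∈ e \ e', lab (f v) = ∑ v ∈ e' \ e, lab (f v) :=
  sum_sdiff_eq_sum_sdiff_iff.symm

theorem Collides.congr (hfg : ∀ v ∈ symmDiff e e', f v = g v) (h : Collides lab e e' f) :
    Collides lab e e' g := by
  rw [collides_iff_sdiff] at h ⊢
  rw [← sum_congr rfl fun v hv => congrArg lab (hfg v (by grind [mem_symmDiff])),
    ← sum_congr rfl fun v hv => congrArg lab (hfg v (by grind [mem_symmDiff]))]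
  exact h

theorem Collides.eq_of_eqOn_ne (hlab : Injective lab) (ha : a ∈ symmDiff e e')
    (hf : Collides lab e e' f) (hg : Collides lab e e' g) (hfg : ∀ v ≠ a, f v = g v) : f = g := by
  wlog hae : a ∈ e generalizing e e'
  · exact this (symmDiff_comm e e' ▸ ha) hf.symm hg.symm (by grind [mem_symmDiff])
  have hae' : a ∉ e' := by grind [mem_symmDiff]
  unfold Collides at hf hg
  rw [← add_sum_erase _ _ hae] at hf hg
  rw [sum_congr rfl fun v hv => congrArg lab (hfg v (ne_of_mem_erase hv)),
    sum_congr rfl fun v hv => congrArg lab (hfg v (ne_of_mem_of_not_mem hv hae')), ← hg] at hf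
  have := hlab (add_right_cancel hf)
  ext v
  grind

end Collision

theorem card_mul_card_le_of_update {V A : Type*} [Fintype A] [DecidableEq V]
    {S Q : Finset (V → A)} (a : V) (hQS : Q ⊆ S) (hS : ∀ f ∈ S, ∀ x, update f a x ∈ S)
    (hQ : ∀ f ∈ Q, ∀ g ∈ Q, (∀ v ≠ a, f v = g v) → f = g) :
    #Q * Fintype.card A ≤ #S := by
  rw [← card_univ, ← card_product]
  refine card_le_card_of_injOn (fun p => update p.1 a p.2)
    (fun p hp => hS _ (hQS (mem_product.1 hp).1) _) ?_
  rintro ⟨f, x⟩ hp ⟨g, y⟩ hq h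
  simp only [coe_product, Set.mem_prod, mem_coe] at hp hq h
  have hxy : x = y := by simpa using congrFun h a
  have hfg : f = g := hQ f hp.1 g hq.1 fun v hv => by simpa [hv] using congrFun h v
  rw [hxy, hfg]

/-- Choosing the values of `f` in increasing order of `r`, at each vertex at most half of the
values are excluded, so a constant proportion of all `f` avoids every collision in `P`. -/
theorem exp_mul_card_pow_le_card_not_collides {V A : Type*} [Fintype V] [DecidableEq V] [Fintype A]
    {lab : A → ℕ} (hlab : Injective lab) {M : ℕ} (hM : 0 < M) (hA : Fintype.card A = 2 * M)
    {r : V → ℕ} (hr : Injective r) (P : Finset (Finset V × Finset V))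
    (last : Finset V × Finset V → V) (hlast : ∀ p ∈ P, last p ∈ symmDiff p.1 p.2)
    (hmax : ∀ p ∈ P, ∀ v ∈ symmDiff p.1 p.2, r v ≤ r (last p))
    (hP : ∀ v, #{p ∈ P | last p = v} ≤ M) :
    open Classical in
    Real.exp (-(#P / M : ℝ)) * (2 * M : ℝ) ^ Fintype.card V ≤
      #{f : V → A | ∀ p ∈ P, ¬ Collides lab p.1 p.2 f} := by
  classical
  let G (s : Finset V) : Finset (V → A) := {f | ∀ p ∈ P, last p ∈ s → ¬ Collides lab p.1 p.2 f}
  have key (s : Finset V) :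
      Real.exp (-(∑ v ∈ s, (#{p ∈ P | last p = v} : ℝ)) / M) * (2 * M : ℝ) ^ Fintype.card V ≤
        #(G s) := by
    induction s using Finset.induction_on_max_value r with
    | empty => simp [G, hA]
    | insert a s ha hs ih =>
      set Pa := {p ∈ P | last p = a} with hPa
      have hfib (p) (hp : p ∈ Pa) : #{f ∈ G s | Collides lab p.1 p.2 f} * (2 * M) ≤ #(G s) := by
        rw [← hA]
        obtain ⟨hpP, hpa⟩ := mem_filter.1 hp
        refine card_mul_card_le_of_update a (filter_subset _ _) ?_ ?_
        · intro f hf x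
          simp only [G, mem_filter, mem_univ, true_and] at hf ⊢
          refine fun q hq hqs hc => hf q hq hqs (hc.congr fun v hv => ?_)
          refine update_of_ne ?_ _ _
          rintro rfl
          have := hr (le_antisymm (hmax q hq v hv) (hs _ hqs))
          exact ha (this ▸ hqs)
        · intro f hf g hg
          exact (mem_filter.1 hf).2.eq_of_eqOn_ne hlab (hpa ▸ hlast p hpP) (mem_filter.1 hg).2
      have hcover : G s ⊆ G (insert a s) ∪ Pa.biUnion fun p => {f ∈ G s | Collides lab p.1 p.2 f} := by
        intro f hf
        by_cases h : f ∈ G (insert a s)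
        · exact mem_union_left _ h
        · refine mem_union_right _ ?_
          have hf' := hf
          simp only [G, mem_filter, mem_univ, true_and, mem_insert, not_forall, not_not] at h hf'
          obtain ⟨p, hp, hpa, hc⟩ := h
          have hpa : last p = a := hpa.resolve_right fun hps => hf' p hp hps hc
          exact mem_biUnion.2 ⟨p, mem_filter.2 ⟨hp, hpa⟩, mem_filter.2 ⟨hf, hc⟩⟩
      have hcount : #(G s) * (2 * M) ≤ #(G (insert a s)) * (2 * M) + #Pa * #(G s) := by
        calc #(G s) * (2 * M)
            ≤ (#(G (insert a s)) + ∑ p ∈ Pa, #{f ∈ G s | Collides lab p.1 p.2 f}) * (2 * M) := by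
              gcongr
              exact (card_le_card hcover).trans
                ((card_union_le _ _).trans (Nat.add_le_add_left card_biUnion_le _))
          _ ≤ _ := by
              rw [add_mul, sum_mul]
              exact Nat.add_le_add_left (sum_le_card_nsmul _ _ _ hfib) _
      have hMR : (0 : ℝ) < M := by exact_mod_cast hM
      have hcountR : (#(G s) : ℝ) * (2 * M) ≤ #(G (insert a s)) * (2 * M) + #Pa * #(G s) := by
        exact_mod_cast hcount
      set d : ℝ := #Pa / M with hd
      have hPad : (#Pa : ℝ) = d * M := by rw [hd]; field_simp
      have hd0 : 0 ≤ d := div_nonneg (Nat.cast_nonneg _) hMR.le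
      have hd1 : d ≤ 1 := by
        rw [hd, div_le_one hMR]; exact_mod_cast hP a
      have hexp : Real.exp (-d) ≤ 1 - d / 2 := by
        rw [Real.exp_neg, inv_le_iff_one_le_mul₀ (Real.exp_pos d)]
        nlinarith [Real.add_one_le_exp d]
      have hstep : (1 - d / 2) * #(G s) ≤ (#(G (insert a s)) : ℝ) := by
        rw [hPad] at hcountR
        have : (2 * M) * ((1 - d / 2) * #(G s)) ≤ (2 * M) * (#(G (insert a s)) : ℝ) := by
          linarith
        exact le_of_mul_le_mul_left this (by positivity)
      calc _ = Real.exp (-d) * (Real.exp (-(∑ v ∈ s, (#{p ∈ P | last p = v} : ℝ)) / M) *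
              (2 * M : ℝ) ^ Fintype.card V) := by
            rw [sum_insert ha, ← mul_assoc, ← Real.exp_add]
            congr 2
            rw [hd]
            ring
        _ ≤ (1 - d / 2) * #(G s) := by gcongr; linarith
        _ ≤ _ := hstep
  have hsum : ∑ v, (#{p ∈ P | last p = v} : ℝ) = #P := by
    exact_mod_cast (card_eq_sum_card_fiberwise fun p _ => mem_univ (last p)).symm
  have := key univ
  rw [hsum, neg_div] at this
  simpa [G] using this

section Anticoncentration

variable {V : Type*} {M : ℕ}

/-- The labels `1, …, 2M`, split into a residue modulo `M` and a bit. -/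
def bitLabel (M : ℕ) (p : Bool × Fin M) : ℕ := p.2 + 1 + if p.1 then M else 0

theorem bitLabel_injective : Injective (bitLabel M) := by
  rintro ⟨b, x⟩ ⟨c, y⟩ h
  have hx := x.2
  have hy := y.2
  cases b <;> cases c <;> simp [bitLabel, Fin.ext_iff] at h ⊢ <;> omega

theorem one_le_bitLabel (p : Bool × Fin M) : 1 ≤ bitLabel M p := by
  unfold bitLabel; omega

theorem bitLabel_le (p : Bool × Fin M) : bitLabel M p ≤ 2 * M := by
  have := p.2.2
  unfold bitLabel; split_ifs <;> omega

theorem sum_bitLabel (s : Finset V) (f : V → Bool × Fin M) :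
    ∑ v ∈ s, bitLabel M (f v) = ∑ v ∈ s, ((f v).2 + 1 : ℕ) + #{v ∈ s | (f v).1} * M := by
  simp_rw [bitLabel, sum_add_distrib, ← sum_filter, sum_const, smul_eq_mul]

variable [DecidableEq V]

theorem card_filter_eq_decide_mem (e e' : Finset V) (b : V → Bool) :
    #{v ∈ symmDiff e e' | b v = decide (v ∈ e)} + #{v ∈ e' \ e | b v} =
      #{v ∈ e \ e' | b v} + #(e' \ e) := by
  have h : {v ∈ symmDiff e e' | b v = decide (v ∈ e)} =
      {v ∈ e \ e' | b v} ∪ {v ∈ e' \ e | ¬ b v} := by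
    ext v; by_cases v ∈ e <;> by_cases v ∈ e' <;> simp [mem_symmDiff, *]
  rw [h, card_union_of_disjoint, ← card_filter_add_card_filter_not (s := e' \ e) (fun v => b v)]
  · ring
  · rw [disjoint_left]; grind

variable [Fintype V]

/-- For fixed residues, a collision determines the size of a subset of the symmetric difference
that is equivalent to the choice of bits there. -/
theorem card_collides_fiber_le (hM : 0 < M) (e e' : Finset V) (x : V → Fin M) :
    open Classical in
    #{f : V → Bool × Fin M | Collides (bitLabel M) e e' f ∧ (fun v => (f v).2) = x} ≤
      (#(symmDiff e e')).choose (#(symmDiff e e') / 2) * 2 ^ #(symmDiff e e')ᶜ := by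
  classical
  set F : Finset (V → Bool × Fin M) :=
    {f | Collides (bitLabel M) e e' f ∧ (fun v => (f v).2) = x} with hF
  rcases F.eq_empty_or_nonempty with h0 | ⟨f₀, hf₀⟩
  · simp [h0]
  let U (f : V → Bool × Fin M) : Finset V := {v ∈ symmDiff e e' | (f v).1 = decide (v ∈ e)}
  have hU (f) (hf : f ∈ F) : #(U f) = #(U f₀) := by
    obtain ⟨hc, hx⟩ := (mem_filter.1 hf).2
    obtain ⟨hc₀, hx₀⟩ := (mem_filter.1 hf₀).2
    rw [collides_iff_sdiff, sum_bitLabel, sum_bitLabel] at hc hc₀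
    have hx (v) : (f v).2 = (f₀ v).2 := congrFun (hx.trans hx₀.symm) v
    simp only [hx] at hc
    have h := card_filter_eq_decide_mem e e' fun v => (f v).1
    have h₀ := card_filter_eq_decide_mem e e' fun v => (f₀ v).1
    have : #{v ∈ e \ e' | (f v).1} + #{v ∈ e' \ e | (f₀ v).1} =
        #{v ∈ e \ e' | (f₀ v).1} + #{v ∈ e' \ e | (f v).1} := by
      refine Nat.eq_of_mul_eq_mul_right hM ?_
      rw [add_mul, add_mul]
      omega
    simp only [U]
    omega
  calc #F ≤ #(powersetCard #(U f₀) (symmDiff e e') ×ˢ (symmDiff e e')ᶜ.powerset) := by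
        refine card_le_card_of_injOn (fun f => (U f, {v ∈ (symmDiff e e')ᶜ | (f v).1})) ?_ ?_
        · intro f hf
          simp only [coe_product, Set.mem_prod, mem_coe, mem_powersetCard, mem_powerset]
          exact ⟨⟨filter_subset _ _, hU f hf⟩, filter_subset _ _⟩
        · intro f hf g hg hfg
          have hx := (mem_filter.1 hf).2.2.trans (mem_filter.1 hg).2.2.symm
          simp only [Prod.mk.injEq, U] at hfg
          funext v
          refine Prod.ext ?_ (congrFun hx v)
          have h₁ := Finset.ext_iff.1 hfg.1 v
          have h₂ := Finset.ext_iff.1 hfg.2 v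
          simp only [mem_filter, mem_compl] at h₁ h₂
          by_cases hv : v ∈ symmDiff e e'
          · simp only [hv, true_and] at h₁
            revert h₁
            cases (f v).1 <;> cases (g v).1 <;> cases decide (v ∈ e) <;> simp
          · simp only [hv, not_false_eq_true, true_and] at h₂
            exact Bool.eq_iff_iff.2 h₂
    _ ≤ _ := by
        rw [card_product, card_powersetCard, card_powerset]
        exact Nat.mul_le_mul_right _ (Nat.choose_le_middle _ _)

/-- A Littlewood–Offord type bound: the probability that two hyperedges collide under random labels
from `1, …, 2M` is at most `1 / (M √k)`, where `k` is the size of their symmetric difference. -/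
theorem card_symmDiff_mul_card_collides_sq_le (hM : 0 < M) {e e' : Finset V} (he : e ≠ e') :
    open Classical in
    #(symmDiff e e') * (#{f : V → Bool × Fin M | Collides (bitLabel M) e e' f} * M) ^ 2 ≤
      ((2 * M) ^ Fintype.card V) ^ 2 := by
  classical
  have : NeZero M := ⟨hM.ne'⟩
  set D := symmDiff e e' with hD
  obtain ⟨a, ha⟩ : D.Nonempty := by
    rw [nonempty_iff_ne_empty]; exact fun h => he (symmDiff_eq_bot.1 h)
  let lab (x : Fin M) : ZMod M := ((x + 1 : ℕ) : ZMod M)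
  have hlab : Injective lab := by
    intro x y h
    simp only [lab, Nat.cast_add, Nat.cast_one, add_left_inj] at h
    rw [ZMod.natCast_eq_natCast_iff'] at h
    rwa [Nat.mod_eq_of_lt x.2, Nat.mod_eq_of_lt y.2, ← Fin.ext_iff] at h
  set X : Finset (V → Fin M) := {x | Collides lab e e' x} with hX
  have hXcard : #X * M ≤ M ^ Fintype.card V := by
    have := card_mul_card_le_of_update (Q := X) (S := univ) a (subset_univ _) (by simp)
      fun f hf g hg => (mem_filter.1 hf).2.eq_of_eqOn_ne hlab ha (mem_filter.1 hg).2
    simpa using this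
  have hQ : #{f : V → Bool × Fin M | Collides (bitLabel M) e e' f} ≤
      (#D).choose (#D / 2) * 2 ^ #Dᶜ * #X := by
    refine card_le_mul_card_image_of_maps_to (f := fun f v => (f v).2) ?_ _ ?_
    · intro f hf
      have h := (mem_filter.1 hf).2
      rw [Collides, sum_bitLabel, sum_bitLabel] at h
      have h := congrArg (Nat.cast : ℕ → ZMod M) h
      refine mem_filter.2 ⟨mem_univ _, ?_⟩
      simpa [Collides, lab] using h
    · intro x _
      rw [filter_filter]
      exact card_collides_fiber_le hM e e' x
  calc _ ≤ #D * ((#D).choose (#D / 2) * 2 ^ #Dᶜ * #X * M) ^ 2 := by gcongr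
    _ = #D * (#D).choose (#D / 2) ^ 2 * 4 ^ #Dᶜ * (#X * M) ^ 2 := by
        rw [show 4 = 2 ^ 2 from rfl, ← pow_mul]; ring
    _ ≤ 4 ^ #D * 4 ^ #Dᶜ * (M ^ Fintype.card V) ^ 2 := by
        gcongr
        exact mul_choose_sq_le _ _
    _ = _ := by
        rw [← pow_add, card_add_card_compl, show 4 = 2 ^ 2 from rfl, ← pow_mul]
        ring

end Anticoncentration

/-- Pairs of sets whose symmetric difference lies in a fixed small set are few. -/
theorem card_filter_symmDiff_subset_le {V : Type*} [DecidableEq V] (E : Finset (Finset V))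
    (B : Finset V) : #{p ∈ E ×ˢ E | symmDiff p.1 p.2 ⊆ B} ≤ #E * 2 ^ #B := by
  rw [← card_powerset, ← card_product]
  refine card_le_card_of_injOn (fun p => (p.1, symmDiff p.1 p.2)) ?_ ?_
  · intro p hp
    obtain ⟨hp, hpB⟩ := mem_filter.1 hp
    exact mem_product.2 ⟨(mem_product.1 hp).1, mem_powerset.2 hpB⟩
  · rintro ⟨e, e'⟩ _ ⟨g, g'⟩ _ h
    simp only [Prod.mk.injEq] at h ⊢
    obtain ⟨rfl, h⟩ := h
    exact ⟨rfl, symmDiff_right_injective e h⟩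

/-- A labeling exists as soon as `M` is a constant fraction of `m²`, where `K` is large in terms of
this fraction `L⁻¹` and `m` is large in terms of both. -/
theorem exists_sumDistinguishing_le {n M K L : ℕ} [NeZero n] (hM : 0 < M) (E : Finset (Finset (Fin n)))
    (hL : #E ^ 2 ≤ L * M) (hK : L * Real.exp L < √K) (hE : #E * 2 ^ (L * K) ≤ M) :
    ∃ f : Fin n → ℕ, SumDistinguishing E f ∧ ∀ v, f v ≤ 2 * M := by
  classical
  set P := {p ∈ E.offDiag | #(symmDiff p.1 p.2) ≤ K} with hPdef
  set Q := {p ∈ E.offDiag | K < #(symmDiff p.1 p.2)} with hQdef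
  have hoff : #E.offDiag ≤ L * M := by
    rw [offDiag_card]; exact (Nat.sub_le _ _).trans (by rwa [← sq])
  have hPcard : #P ≤ L * M := (card_filter_le _ _).trans hoff
  have hQcard : #Q ≤ L * M := (card_filter_le _ _).trans hoff
  set B : Finset (Fin n) := {v | M < #{p ∈ P | v ∈ symmDiff p.1 p.2}} with hB
  have hBcard : #B ≤ L * K := by
    refine Nat.le_of_mul_le_mul_right ?_ hM
    calc #B * M ≤ ∑ v ∈ B, #{p ∈ P | v ∈ symmDiff p.1 p.2} :=
          card_nsmul_le_sum _ _ _ fun v hv => (mem_filter.1 hv).2.le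
      _ ≤ ∑ v, #{p ∈ P | v ∈ symmDiff p.1 p.2} :=
          sum_le_sum_of_subset (subset_univ _)
      _ = ∑ p ∈ P, #(symmDiff p.1 p.2) := by
          have := sum_card_bipartiteAbove_eq_sum_card_bipartiteBelow (s := univ) (t := P)
            fun (v : Fin n) p => v ∈ symmDiff p.1 p.2
          simpa [bipartiteAbove, bipartiteBelow] using this
      _ ≤ #P * K := sum_le_card_nsmul _ _ _ fun p hp => (mem_filter.1 hp).2
      _ ≤ L * M * K := by gcongr
      _ = L * K * M := by ring
  let r (v : Fin n) : ℕ := if v ∈ B then v else n + v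
  have hr : Injective r := by
    intro v w h
    have hv := v.2
    have hw := w.2
    simp only [r] at h
    split_ifs at h <;> omega
  have hne (p) (hp : p ∈ E.offDiag) : (symmDiff p.1 p.2).Nonempty := by
    rw [nonempty_iff_ne_empty]
    exact fun h => (mem_offDiag.1 hp).2.2 (symmDiff_eq_bot.1 h)
  have hlast (p : Finset (Fin n) × Finset (Fin n)) : ∃ v, p ∈ P →
      v ∈ symmDiff p.1 p.2 ∧ ∀ w ∈ symmDiff p.1 p.2, r w ≤ r v := by
    by_cases hp : p ∈ P
    · obtain ⟨v, hv⟩ := exists_max_image _ r (hne p (mem_filter.1 hp).1)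
      exact ⟨v, fun _ => hv⟩
    · exact ⟨0, fun h => absurd h hp⟩
  choose last hlast using hlast
  have hPM (v : Fin n) : #{p ∈ P | last p = v} ≤ M := by
    by_cases hv : v ∈ B
    · calc _ ≤ #{p ∈ E ×ˢ E | symmDiff p.1 p.2 ⊆ B} := by
            refine card_le_card fun p hp => ?_
            obtain ⟨hpP, rfl⟩ := mem_filter.1 hp
            obtain ⟨h₁, h₂, -⟩ := mem_offDiag.1 (mem_filter.1 hpP).1
            refine mem_filter.2 ⟨mem_product.2 ⟨h₁, h₂⟩, fun w hw => ?_⟩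
            by_contra hwB
            have := (hlast p hpP).2 w hw
            simp only [r, hv, hwB, if_true, if_false] at this
            omega
        _ ≤ #E * 2 ^ #B := card_filter_symmDiff_subset_le E B
        _ ≤ #E * 2 ^ (L * K) := by gcongr; norm_num
        _ ≤ M := hE
    · calc _ ≤ #{p ∈ P | v ∈ symmDiff p.1 p.2} := by
            refine card_le_card fun p hp => ?_
            obtain ⟨hpP, rfl⟩ := mem_filter.1 hp
            exact mem_filter.2 ⟨hpP, (hlast p hpP).1⟩
        _ ≤ M := by simpa [hB] using hv
  have hgood := exp_mul_card_pow_le_card_not_collides (bitLabel_injective (M := M)) hM (by simp)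
    hr P last (fun p hp => (hlast p hp).1) (fun p hp => (hlast p hp).2) hPM
  set T : ℝ := (2 * M : ℝ) ^ n with hT
  rw [Fintype.card_fin] at hgood
  have hMR : (0 : ℝ) < M := by exact_mod_cast hM
  have hTpos : 0 < T := by positivity
  have hKpos : 0 < √(K : ℝ) := lt_of_le_of_lt (by positivity) hK
  set G : Finset (Fin n → Bool × Fin M) := {f | ∀ p ∈ P, ¬ Collides (bitLabel M) p.1 p.2 f}
  let Z (p : Finset (Fin n) × Finset (Fin n)) : Finset (Fin n → Bool × Fin M) :=
    {f | Collides (bitLabel M) p.1 p.2 f}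
  have hZ (p) (hp : p ∈ Q) : (#(Z p) : ℝ) ≤ T / (M * √K) := by
    obtain ⟨hp, hKp⟩ := mem_filter.1 hp
    have h := card_symmDiff_mul_card_collides_sq_le hM (mem_offDiag.1 hp).2.2
    have h : K * (#(Z p) * M) ^ 2 ≤ ((2 * M) ^ n) ^ 2 := by
      rw [Fintype.card_fin] at h
      exact (Nat.mul_le_mul_right _ hKp.le).trans h
    have h : (K : ℝ) * (#(Z p) * M) ^ 2 ≤ T ^ 2 := by rw [hT]; exact_mod_cast h
    rw [le_div_iff₀ (by positivity)]
    refine le_of_sq_le_sq ?_ hTpos.le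
    calc _ = (√(K : ℝ)) ^ 2 * (#(Z p) * M) ^ 2 := by ring
      _ ≤ T ^ 2 := by rwa [Real.sq_sqrt (Nat.cast_nonneg K)]
  have hbad : (#(Q.biUnion Z) : ℝ) < #G := by
    calc (#(Q.biUnion Z) : ℝ) ≤ ∑ p ∈ Q, (#(Z p) : ℝ) := by exact_mod_cast card_biUnion_le
      _ ≤ #Q * (T / (M * √K)) := by
          rw [← nsmul_eq_mul]; exact sum_le_card_nsmul _ _ _ hZ
      _ ≤ (L * M) * (T / (M * √K)) := by
          gcongr; exact_mod_cast hQcard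
      _ = L / √K * T := by field_simp
      _ < Real.exp (-L) * T := by
          gcongr
          rw [div_lt_iff₀ hKpos, Real.exp_neg, ← div_eq_inv_mul, lt_div_iff₀ (Real.exp_pos _)]
          exact hK
      _ ≤ Real.exp (-(#P / M)) * T := by
          gcongr
          rw [div_le_iff₀ hMR]
          exact_mod_cast hPcard
      _ ≤ #G := hgood
  obtain ⟨f, hfG, hfZ⟩ := exists_mem_notMem_of_card_lt_card (Nat.cast_lt.1 hbad)
  refine ⟨fun v => bitLabel M (f v), ⟨fun v => one_le_bitLabel _, ?_⟩, fun v => bitLabel_le _⟩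
  intro e he e' he' hee hsum
  have hoffp : (e, e') ∈ E.offDiag := mem_offDiag.2 ⟨he, he', hee⟩
  by_cases hk : #(symmDiff e e') ≤ K
  · exact (mem_filter.1 hfG).2 (e, e') (mem_filter.2 ⟨hoffp, hk⟩) hsum
  · exact hfZ (mem_biUnion.2 ⟨(e, e'), mem_filter.2 ⟨hoffp, not_le.1 hk⟩,
      mem_filter.2 ⟨mem_univ _, hsum⟩⟩)

/-- For every real `C > 0` there exists `n₀` such that for every `n > n₀` and every `m ≥ n`,
every hypergraph on `n` vertices with `m` hyperedges admits a sum-distinguishing labeling whose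
labels are all at most `⌈m²/C⌉`. -/
theorem stmt1 (C : ℝ) (hC : 0 < C) :
    ∃ n₀ : ℕ, ∀ n : ℕ, n₀ < n → ∀ m : ℕ, n ≤ m →
      ∀ E : Finset (Finset (Fin n)), E.card = m →
        ∃ f : Fin n → ℕ, SumDistinguishing E f ∧ ∀ v, f v ≤ ⌈(m : ℝ) ^ 2 / C⌉₊ := by
  obtain ⟨L, hL⟩ := exists_nat_gt (4 * C)
  obtain ⟨K, hK⟩ := exists_nat_gt ((L * Real.exp L) ^ 2)
  obtain ⟨n₀, hn₀⟩ := exists_nat_gt (L * 2 ^ (L * K) + L : ℝ)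
  refine ⟨n₀, fun n hn m hm E hE => ?_⟩
  have : NeZero n := ⟨by omega⟩
  set M := ⌊(m : ℝ) ^ 2 / (2 * C)⌋₊ with hMdef
  have hLpos : (0 : ℝ) < L := by linarith
  have hL1 : (1 : ℝ) ≤ L := by exact_mod_cast (Nat.cast_pos.1 hLpos : 0 < L)
  have hpow : (0 : ℝ) < 2 ^ (L * K) := by positivity
  have hmR : (L * 2 ^ (L * K) + L : ℝ) < m := hn₀.trans (by exact_mod_cast hn.trans_le hm)
  have hmL : (L : ℝ) ≤ m := by nlinarith
  have hM_le : (M : ℝ) ≤ (m : ℝ) ^ 2 / (2 * C) := Nat.floor_le (by positivity)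
  have hM_gt : (m : ℝ) ^ 2 / (2 * C) < M + 1 := Nat.lt_floor_add_one _
  rw [le_div_iff₀ (by positivity)] at hM_le
  rw [div_lt_iff₀ (by positivity)] at hM_gt
  have hMpos : 0 < M := by
    rw [hMdef, Nat.floor_pos, le_div_iff₀ (by positivity)]
    nlinarith
  have hM1 : (1 : ℝ) ≤ M := by exact_mod_cast hMpos
  have hmLM : (m : ℝ) ^ 2 ≤ L * M := by nlinarith
  obtain ⟨f, hf, hfM⟩ := exists_sumDistinguishing_le (L := L) (K := K) hMpos E
    (by rw [hE]; exact_mod_cast hmLM) (Real.lt_sqrt_of_sq_lt hK) (by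
      rw [hE, ← Nat.cast_le (α := ℝ)]
      push_cast
      refine le_of_mul_le_mul_left ?_ hLpos
      calc (L : ℝ) * (m * 2 ^ (L * K)) = m * (L * 2 ^ (L * K)) := by ring
        _ ≤ m * m := by gcongr; linarith
        _ ≤ L * M := by rwa [← sq])
  refine ⟨f, hf, fun v => (hfM v).trans ?_⟩
  rw [← Nat.cast_le (α := ℝ)]
  refine le_trans ?_ (Nat.le_ceil _)
  push_cast
  rw [le_div_iff₀ hC]
  linarith
end

section
/- Every hypergraph H with m ≥ 2 hyperedges satisfies s(H) ≤ m²; that is, H admits a sum-distinguishing labeling whose labels are all at most m². -/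
open Classical in
/-- Labels can be chosen greedily, one vertex at a time: each ordered pair of distinct hyperedges
forbids at most one value for the next label. -/
theorem exists_labeling_distinguishing_on {V : Type*} (E : Finset (Finset V)) (N : ℕ)
    (hN : E.offDiag.card < N) (S : Finset V) :
    ∃ f : V → ℕ, (∀ v, 1 ≤ f v ∧ f v ≤ N) ∧ ∀ e ∈ E, ∀ e' ∈ E, e ∩ S ≠ e' ∩ S →
      ∑ v ∈ e ∩ S, f v ≠ ∑ v ∈ e' ∩ S, f v := by
  induction S using Finset.induction_on with
  | empty => exact ⟨fun _ => 1, fun _ => ⟨le_rfl, Nat.one_le_of_lt hN⟩, by simp⟩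
  | insert a S ha ih =>
    obtain ⟨f, hf, hd⟩ := ih
    let bad : Finset ℕ :=
      E.offDiag.image fun p => ∑ v ∈ p.1 ∩ S, f v - ∑ v ∈ p.2 ∩ S, f v
    obtain ⟨x, hx, hxbad⟩ : ∃ x ∈ Finset.Icc 1 N, x ∉ bad := by
      apply Finset.exists_mem_notMem_of_card_lt_card
      calc bad.card ≤ E.offDiag.card := Finset.card_image_le
        _ < (Finset.Icc 1 N).card := by simpa using hN
    rw [Finset.mem_Icc] at hx
    have hsum (e : Finset V) :
        ∑ v ∈ e ∩ S, Function.update f a x v = ∑ v ∈ e ∩ S, f v :=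
      Finset.sum_update_of_notMem (by simp [ha]) f x
    have hx_ne : ∀ e ∈ E, ∀ e' ∈ E, e ≠ e' →
        x + ∑ v ∈ e' ∩ S, f v ≠ ∑ v ∈ e ∩ S, f v := by
      intro e he e' he' hne h
      exact hxbad (Finset.mem_image.2 ⟨(e, e'), Finset.mem_offDiag.2 ⟨he, he', hne⟩,
        by dsimp only; omega⟩)
    refine ⟨Function.update f a x, fun v => ?_, fun e he e' he' hne => ?_⟩
    · by_cases hv : v = a
      · subst hv
        simpa using hx
      · simpa [hv] using hf v
    · have hee' : e ≠ e' := fun h => hne (by rw [h])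
      by_cases hae : a ∈ e <;> by_cases hae' : a ∈ e'
      · rw [Finset.inter_insert_of_mem hae, Finset.inter_insert_of_mem hae'] at hne ⊢
        rw [Finset.sum_insert (by simp [ha]), Finset.sum_insert (by simp [ha]), hsum, hsum]
        have := hd e he e' he' fun h => hne (by rw [h])
        omega
      · rw [Finset.inter_insert_of_mem hae, Finset.inter_insert_of_notMem hae',
          Finset.sum_insert (by simp [ha]), hsum, hsum, Function.update_self]
        exact hx_ne e' he' e he hee'.symm
      · rw [Finset.inter_insert_of_notMem hae, Finset.inter_insert_of_mem hae',
          Finset.sum_insert (by simp [ha]), hsum, hsum, Function.update_self]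
        exact (hx_ne e he e' he' hee').symm
      · rw [Finset.inter_insert_of_notMem hae, Finset.inter_insert_of_notMem hae'] at hne ⊢
        rw [hsum, hsum]
        exact hd e he e' he' hne

/-- Every hypergraph with `m ≥ 2` hyperedges admits a sum-distinguishing labeling whose labels
are all at most `m²`. -/
theorem stmt2 {V : Type*} [Fintype V] (E : Finset (Finset V)) (m : ℕ) (hm : 2 ≤ m)
    (hcard : E.card = m) :
    ∃ f : V → ℕ, SumDistinguishing E f ∧ ∀ v, f v ≤ m ^ 2 := by
  classical
  have hN : E.offDiag.card < m ^ 2 := by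
    rw [Finset.offDiag_card, hcard, pow_two]
    exact Nat.sub_lt (by positivity) (by omega)
  obtain ⟨f, hf, hd⟩ := exists_labeling_distinguishing_on E (m ^ 2) hN Finset.univ
  exact ⟨f, ⟨fun v => (hf v).1, by simpa using hd⟩, fun v => (hf v).2⟩
end

section
/- For every real ε with 0 < ε < 1 there exists n₀ such that for every integer n > n₀ there exists a graph G on n vertices with s*(G) ≥ n^{2-ε}; that is, G admits no vertex sum-distinguishing labeling whose labels are all at most n^{2-ε}. -/
open Classical in
/-- The closed neighborhood of a vertex `v` in a graph `G`, as a `Finset`. -/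
noncomputable def closedNbr {V : Type*} [Fintype V] (G : SimpleGraph V) (v : V) : Finset V :=
  Finset.univ.filter (fun u => u = v ∨ G.Adj u v)

/-- A labeling of the vertices of a graph `G` by positive integers is vertex sum-distinguishing
if any two vertices with distinct closed neighborhoods receive distinct sums of labels over
their closed neighborhoods. -/
def VertexSumDistinguishing {V : Type*} [Fintype V] (G : SimpleGraph V) (f : V → ℕ) : Prop :=
  (∀ v, 1 ≤ f v) ∧ ∀ u v : V, closedNbr G u ≠ closedNbr G v →
    ∑ x ∈ closedNbr G u, f x ≠ ∑ x ∈ closedNbr G v, f x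

lemma sum_injOn_pow_card_le {α β : Type*} [Fintype α] [DecidableEq α] [Fintype β] [DecidableEq β]
    (s : α → β) {t : ℝ} (ht : 0 ≤ t) (F : Finset (Finset α))
    (hF : ∀ X ∈ F, Set.InjOn s (X : Set α)) :
    ∑ X ∈ F, t ^ X.card ≤ ∏ b, (1 + (Finset.univ.filter (fun a => s a = b)).card * t) := by
  classical
  let P : β → Finset (Finset α) := fun b =>
    insert ∅ ((Finset.univ.filter (fun a => s a = b)).image fun a => {a})
  have hP : ∀ b, ∑ Y ∈ P b, t ^ Y.card = 1 + (Finset.univ.filter (fun a => s a = b)).card * t := by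
    intro b
    rw [Finset.sum_insert (by simp), Finset.sum_image (by simp)]
    simp
  simp_rw [← hP]
  rw [Finset.prod_univ_sum]
  let φ : Finset α → β → Finset α := fun X b => X.filter (fun a => s a = b)
  have hφ : Function.Injective φ := by
    intro X Y h
    ext a
    have := congrArg (fun Z => a ∈ Z) (congrFun h (s a))
    simpa [φ] using this
  calc ∑ X ∈ F, t ^ X.card = ∑ X ∈ F, ∏ b, t ^ (φ X b).card := by
        refine Finset.sum_congr rfl fun X _ => ?_
        rw [Finset.prod_pow_eq_pow_sum,
          ← Finset.card_eq_sum_card_fiberwise (f := s) (s := X) (t := Finset.univ) (by simp)]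
    _ = ∑ p ∈ F.image φ, ∏ b, t ^ (p b).card := by
        rw [Finset.sum_image hφ.injOn]
    _ ≤ _ := by
        refine Finset.sum_le_sum_of_subset_of_nonneg ?_ fun _ _ _ => by positivity
        intro p hp
        obtain ⟨X, hX, rfl⟩ := Finset.mem_image.1 hp
        refine Fintype.mem_piFinset.2 fun b => ?_
        rcases (φ X b).eq_empty_or_nonempty with h | ⟨a, ha⟩
        · simp [P, h]
        · refine Finset.mem_insert_of_mem (Finset.mem_image.2 ⟨a, ?_, ?_⟩)
          · simpa using (Finset.mem_filter.1 ha).2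
          · refine (Finset.eq_singleton_iff_unique_mem.2 ⟨ha, fun c hc => ?_⟩).symm
            simp only [φ, Finset.mem_filter] at ha hc
            exact hF X hX hc.1 ha.1 (hc.2.trans ha.2.symm)

lemma prod_one_add_le_pow_s3 {β : Type*} [Fintype β] [Nonempty β] (x : β → ℝ) (hx : ∀ b, 0 ≤ x b) :
    ∏ b, (1 + x b) ≤ (1 + (∑ b, x b) / Fintype.card β) ^ Fintype.card β := by
  set a := (∑ b, x b) / Fintype.card β with ha
  have hc : (Fintype.card β : ℝ) ≠ 0 := by simp
  have ha0 : 0 ≤ a := div_nonneg (Finset.sum_nonneg fun b _ => hx b) (by positivity)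
  calc ∏ b, (1 + x b) ≤ ∏ b, ((1 + a) * Real.exp ((x b - a) / (1 + a))) := by
        refine Finset.prod_le_prod (fun b _ => by linarith [hx b]) fun b _ => ?_
        have h := Real.add_one_le_exp ((x b - a) / (1 + a))
        calc 1 + x b = (1 + a) * ((x b - a) / (1 + a) + 1) := by field_simp; ring
          _ ≤ _ := by gcongr
    _ = (1 + a) ^ Fintype.card β := by
        rw [Finset.prod_mul_distrib, ← Real.exp_sum, ← Finset.sum_div, Finset.sum_sub_distrib]
        have : ∑ b : β, a = ∑ b, x b := by
          simp [ha]; field_simp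
        simp [this]

lemma exists_family_not_injOn (k N m : ℕ) {t : ℝ} (ht : 0 ≤ t)
    (h : ((N : ℝ) + 1) ^ k * (1 + 2 ^ k * t / (k * N + 1 : ℕ)) ^ (k * N + 1)
      + (1 + 2 * t) ^ 2 ^ k / 2 ^ m < (1 + t) ^ 2 ^ k) :
    ∃ X : Finset (Finset (Fin k)), X.card ≤ m ∧ ∀ g : Fin k → ℕ, (∀ i, g i ≤ N) →
      ¬ Set.InjOn (fun S : Finset (Fin k) => ∑ i ∈ S, g i) X := by
  classical
  by_contra! hcon
  have hpow : ∀ x : ℝ, ∑ X : Finset (Finset (Fin k)), x ^ X.card = (1 + x) ^ 2 ^ k := by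
    intro x
    have := Finset.sum_pow_mul_eq_add_pow x 1 (Finset.univ : Finset (Finset (Fin k)))
    simpa [add_comm] using this
  let σ : (Fin k → Fin (N + 1)) → Finset (Fin k) → Fin (k * N + 1) := fun g S =>
    ⟨∑ i ∈ S, (g i : ℕ), by
      refine Nat.lt_succ_of_le ((Finset.sum_le_card_nsmul S _ N fun i _ => by omega).trans ?_)
      exact Nat.mul_le_mul_right N (by simpa using S.card_le_univ)⟩
  let F : (Fin k → Fin (N + 1)) → Finset (Finset (Finset (Fin k))) := fun g =>
    Finset.univ.filter fun X => Set.InjOn (σ g) (X : Set (Finset (Fin k)))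
  have hF : ∀ g, ∑ X ∈ F g, t ^ X.card
      ≤ (1 + 2 ^ k * t / (k * N + 1 : ℕ)) ^ (k * N + 1) := by
    intro g
    refine (sum_injOn_pow_card_le (σ g) ht (F g) fun X hX => (Finset.mem_filter.1 hX).2).trans ?_
    refine (prod_one_add_le_pow_s3 _ fun b => by positivity).trans_eq ?_
    rw [← Finset.sum_mul, ← Nat.cast_sum,
      ← Finset.card_eq_sum_card_fiberwise (f := σ g) (t := Finset.univ) (by simp)]
    simp
  have hX : ∀ X : Finset (Finset (Fin k)),
      t ^ X.card ≤ ∑ g, (if X ∈ F g then t ^ X.card else 0) + (2 * t) ^ X.card / 2 ^ m := by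
    intro X
    have hnn : ∀ g, 0 ≤ (if X ∈ F g then t ^ X.card else 0) := fun g => by positivity
    rcases le_or_gt X.card m with hc | hc
    · obtain ⟨g, hg, hinj⟩ := hcon X hc
      have hmem : X ∈ F (fun i => ⟨g i, Nat.lt_succ_of_le (hg i)⟩) := by
        refine Finset.mem_filter.2 ⟨Finset.mem_univ _, fun a ha b hb hab => hinj ha hb ?_⟩
        simpa [σ] using hab
      have := Finset.single_le_sum (fun g _ => hnn g)
        (Finset.mem_univ (fun i => ⟨g i, Nat.lt_succ_of_le (hg i)⟩ : Fin k → Fin (N + 1)))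
      rw [if_pos hmem] at this
      have : 0 ≤ (2 * t) ^ X.card / 2 ^ m := by positivity
      linarith
    · have h2 : (2 : ℝ) ^ m ≤ 2 ^ X.card := pow_le_pow_right₀ (by norm_num) hc.le
      have : t ^ X.card ≤ (2 * t) ^ X.card / 2 ^ m := by
        rw [le_div_iff₀ (by positivity), mul_pow, mul_comm]
        gcongr
      have := Finset.sum_nonneg fun g (_ : g ∈ Finset.univ) => hnn g
      linarith
  have hsum := Finset.sum_le_sum fun X (_ : X ∈ Finset.univ) => hX X
  rw [Finset.sum_add_distrib, ← Finset.sum_div, hpow, hpow, Finset.sum_comm] at hsum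
  have hbound : ∑ g, ∑ X, (if X ∈ F g then t ^ X.card else 0)
      ≤ ((N : ℝ) + 1) ^ k * (1 + 2 ^ k * t / (k * N + 1 : ℕ)) ^ (k * N + 1) := by
    calc _ ≤ ∑ g : Fin k → Fin (N + 1), (1 + 2 ^ k * t / (k * N + 1 : ℕ)) ^ (k * N + 1) := by
          refine Finset.sum_le_sum fun g _ => ?_
          rw [Finset.sum_ite_mem, Finset.univ_inter]
          exact hF g
      _ = _ := by simp
  linarith

lemma exists_graph_of_family {n k m N : ℕ} (e : Fin n ≃ Fin k ⊕ Fin m)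
    {X : Finset (Finset (Fin k))} (hcard : X.card ≤ m)
    (hX : ∀ g : Fin k → ℕ, (∀ i, g i ≤ N) →
      ¬ Set.InjOn (fun S : Finset (Fin k) => ∑ i ∈ S, g i) X) :
    ∃ G : SimpleGraph (Fin n), ¬ ∃ f : Fin n → ℕ, VertexSumDistinguishing G f ∧ ∀ v, f v ≤ N := by
  classical
  have hne : Nonempty X := by
    by_contra h
    rw [nonempty_subtype, not_exists] at h
    exact hX 0 (by simp) fun a ha => (h a ha).elim
  obtain ⟨ι⟩ := Function.Embedding.nonempty_of_card_le (α := X) (β := Fin m) (by simpa using hcard)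
  let T : Fin m → Finset (Fin k) := fun b => (Function.invFun ι b : X)
  have hT : ∀ S ∈ X, ∃ b, T b = S := fun S hS =>
    ⟨ι ⟨S, hS⟩, by simp [T, Function.leftInverse_invFun ι.injective ⟨S, hS⟩]⟩
  let r : Fin k ⊕ Fin m → Fin k ⊕ Fin m → Prop := fun x y =>
    Sum.elim (fun i => Sum.elim (fun _ => False) (fun b => i ∈ T b) y)
      (fun _ => Sum.elim (fun _ => False) (fun _ => True) y) x
  let G : SimpleGraph (Fin n) := SimpleGraph.fromRel fun u v => r (e u) (e v)
  have hG : ∀ b, closedNbr G (e.symm (Sum.inr b))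
      = ((T b).disjSum Finset.univ).map e.symm.toEmbedding := by
    intro b
    ext u
    obtain ⟨x, rfl⟩ := e.symm.surjective u
    rcases x with i | c
    · simp [closedNbr, G, r, SimpleGraph.fromRel_adj]
    · simp [closedNbr, G, r, SimpleGraph.fromRel_adj, em]
  refine ⟨G, ?_⟩
  rintro ⟨f, ⟨-, hf⟩, hN⟩
  refine hX (fun i => f (e.symm (Sum.inl i))) (fun i => hN _) fun S hS S' hS' hSS' => ?_
  obtain ⟨b, rfl⟩ := hT S hS
  obtain ⟨c, rfl⟩ := hT S' hS'
  by_contra hne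
  refine hf (e.symm (Sum.inr b)) (e.symm (Sum.inr c)) (fun h => hne ?_) ?_
  · rw [hG, hG, Finset.map_inj] at h
    ext i
    have := congrArg (fun Z => Sum.inl i ∈ Z) h
    simpa using this
  · rw [hG, hG]
    simpa [Finset.sum_map, Finset.sum_disjSum] using hSS'

lemma one_add_le_exp_sub {x : ℝ} (h0 : 0 ≤ x) (h1 : x ≤ 1) :
    1 + x ≤ Real.exp (x - x ^ 2 / 4) := by
  refine le_trans ?_ (Real.quadratic_le_exp_of_nonneg (by nlinarith))
  nlinarith [mul_nonneg (sq_nonneg x) (sub_nonneg.2 h1), sq_nonneg (x ^ 2)]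

lemma exp_sub_le_one_add {x : ℝ} (h0 : 0 ≤ x) : Real.exp (x - x ^ 2 / 2) ≤ 1 + x := by
  rw [← Real.le_log_iff_exp_le (by linarith)]
  refine le_trans ?_ (Real.le_log_one_add_of_nonneg h0)
  rw [le_div_iff₀ (by linarith)]
  nlinarith [pow_nonneg h0 3]

/-- The numerical inequality driving the union bound. -/
lemma weight_lt {L lam : ℝ} {M Q m : ℕ} (hm : 1 ≤ m) (hM : 0 < M) (hL0 : 0 < L)
    (hlam : lam = m / 4) (hlM : lam ≤ M) (hQ : 4 * M ≤ Q)
    (hL : Real.log L + Real.log 4 ≤ lam ^ 2 / (8 * M)) :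
    L * (1 + Q * (lam / Q) / M) ^ M + (1 + 2 * (lam / Q)) ^ Q / 2 ^ m < (1 + lam / Q) ^ Q := by
  have hM' : (0 : ℝ) < M := by exact_mod_cast hM
  have hQ' : (4 : ℝ) * M ≤ Q := by exact_mod_cast hQ
  have hQ0 : (0 : ℝ) < Q := by linarith
  have hl0 : 0 ≤ lam := by rw [hlam]; positivity
  have hW : Real.exp (lam - lam ^ 2 / (8 * M)) ≤ (1 + lam / Q) ^ Q := by
    calc _ ≤ Real.exp (lam - lam ^ 2 / (2 * Q)) := by
          have : lam ^ 2 / (2 * Q) ≤ lam ^ 2 / (8 * M) :=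
            div_le_div_of_nonneg_left (by positivity) (by positivity) (by linarith)
          exact Real.exp_le_exp.2 (by linarith)
      _ = Real.exp (lam / Q - (lam / Q) ^ 2 / 2) ^ Q := by
          rw [← Real.exp_nat_mul]; congr 1; field_simp
      _ ≤ _ := by gcongr; exact exp_sub_le_one_add (by positivity)
  have hfirst : L * (1 + Q * (lam / Q) / M) ^ M ≤ (1 + lam / Q) ^ Q / 4 := by
    have h1 : (1 + Q * (lam / Q) / M) ^ M ≤ Real.exp (lam - lam ^ 2 / (4 * M)) := by
      calc _ = (1 + lam / M) ^ M := by congr 3; field_simp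
        _ ≤ Real.exp (lam / M - (lam / M) ^ 2 / 4) ^ M := by
          gcongr
          exact one_add_le_exp_sub (by positivity) ((div_le_one hM').2 hlM)
        _ = _ := by rw [← Real.exp_nat_mul]; congr 1; field_simp
    have h2 : L * 4 ≤ Real.exp (lam ^ 2 / (8 * M)) := by
      rw [← Real.log_le_iff_le_exp (by positivity), Real.log_mul hL0.ne' (by norm_num)]
      exact hL
    have h3 : Real.exp (lam ^ 2 / (8 * M)) * Real.exp (lam - lam ^ 2 / (4 * M))
        = Real.exp (lam - lam ^ 2 / (8 * M)) := by
      rw [← Real.exp_add]; congr 1; field_simp; ring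
    have := mul_le_mul h2 h1 (by positivity) (by positivity)
    linarith
  have hsecond : (1 + 2 * (lam / Q)) ^ Q / 2 ^ m ≤ (1 + lam / Q) ^ Q * (2 / 3) := by
    have h1 : (1 + 2 * (lam / Q)) ^ Q ≤ (1 + lam / Q) ^ Q * (1 + lam / Q) ^ Q := by
      rw [← mul_pow]
      gcongr
      nlinarith [sq_nonneg (lam / Q)]
    have h2 : (1 + lam / Q) ^ Q ≤ Real.exp (1 / 4) ^ m := by
      calc _ ≤ Real.exp (lam / Q) ^ Q := by
            gcongr
            linarith [Real.add_one_le_exp (lam / Q)]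
        _ = _ := by
            rw [← Real.exp_nat_mul, ← Real.exp_nat_mul, hlam]; congr 1; field_simp
    have h3 : Real.exp (1 / 4) ≤ 4 / 3 := by
      have := Real.one_sub_le_exp_neg (1 / 4 : ℝ)
      rw [Real.exp_neg, ← one_div, le_div_iff₀ (Real.exp_pos _)] at this
      linarith
    have h4 : Real.exp (1 / 4) ^ m ≤ 2 / 3 * 2 ^ m := by
      calc _ ≤ (4 / 3 : ℝ) ^ m := by gcongr
        _ = (2 / 3) ^ m * 2 ^ m := by rw [← mul_pow]; norm_num
        _ ≤ _ := by
          gcongr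
          exact pow_le_of_le_one (by norm_num) (by norm_num) (by omega)
    rw [div_le_iff₀ (by positivity)]
    calc _ ≤ _ := h1
      _ ≤ (1 + lam / Q) ^ Q * (2 / 3 * 2 ^ m) := by gcongr; exact h2.trans h4
      _ = _ := by ring
  have : (0 : ℝ) < (1 + lam / Q) ^ Q := by positivity
  linarith

open Filter in
lemma eventually_rpow_bounds {a : ℝ} (ha : 0 < a) (ha1 : a < 1 / 3) :
    ∀ᶠ n : ℕ in atTop, 2 * (n : ℝ) ^ a ≤ n / 2 ∧ Real.log n ≤ (n : ℝ) ^ a / 20000 ∧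
      20000 ≤ (n : ℝ) ^ a ∧ 12 ≤ n := by
  have h1 := ((isLittleO_log_rpow_atTop ha).bound (c := 1 / 20000) (by norm_num)).natCast_atTop
  have h2 := (((tendsto_rpow_atTop ha).comp tendsto_natCast_atTop_atTop).eventually_ge_atTop 20000)
  have h3 := (((tendsto_rpow_atTop (y := 1 - a) (by linarith)).comp
    tendsto_natCast_atTop_atTop).eventually_ge_atTop (4 : ℝ))
  filter_upwards [h1, h2, h3, eventually_ge_atTop 12] with n h1 h2 h3 h4
  have hn : (0 : ℝ) < n := by positivity
  refine ⟨?_, ?_, h2, h4⟩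
  · simp only [Function.comp] at h3
    have : (n : ℝ) ^ a * (n : ℝ) ^ (1 - a) = n := by
      rw [← Real.rpow_add hn]; simp
    nlinarith [Real.rpow_pos_of_pos hn a]
  · rw [Real.norm_of_nonneg (Real.log_natCast_nonneg n), Real.norm_of_nonneg (by positivity)] at h1
    linarith

/-- For every real `ε` with `0 < ε < 1` there exists `n₀` such that for every `n > n₀` there is
a graph on `n` vertices admitting no vertex sum-distinguishing labeling whose labels are all at
most `n^(2-ε)`. -/
theorem stmt3 (ε : ℝ) (hε0 : 0 < ε) (hε1 : ε < 1) :
    ∃ n₀ : ℕ, ∀ n : ℕ, n₀ < n →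
      ∃ G : SimpleGraph (Fin n),
        ¬ ∃ f : Fin n → ℕ, VertexSumDistinguishing G f ∧ ∀ v, (f v : ℝ) ≤ (n : ℝ) ^ (2 - ε) := by
  obtain ⟨n₀, hn₀⟩ := Filter.eventually_atTop.1
    (eventually_rpow_bounds (a := ε / 3) (by linarith) (by linarith))
  refine ⟨n₀, fun n hn => ?_⟩
  obtain ⟨hhalf, hlog, hlarge, h12⟩ := hn₀ n hn.le
  have hnR : (12 : ℝ) ≤ n := by exact_mod_cast h12
  have hn0 : (0 : ℝ) < n := by linarith
  set A : ℝ := (n : ℝ) ^ (ε / 3) with hA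
  set B : ℝ := (n : ℝ) ^ (2 - ε) with hB
  set k := ⌈A⌉₊ with hk
  set N := ⌊B⌋₊ with hN
  have hA0 : 0 < A := by linarith
  have hkA : A ≤ k := Nat.le_ceil A
  have hk2 : (k : ℝ) ≤ 2 * A := by
    have := Nat.ceil_lt_add_one hA0.le
    linarith
  have hNB : (N : ℝ) ≤ B := Nat.floor_le (by positivity)
  have hBN : B < N + 1 := Nat.lt_floor_add_one B
  have hnB : (n : ℝ) ≤ B := by
    calc (n : ℝ) = (n : ℝ) ^ (1 : ℝ) := by simp
      _ ≤ _ := Real.rpow_le_rpow_of_exponent_le (by linarith) (by linarith)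
  have hABn : A ^ 3 * B = (n : ℝ) ^ 2 := by
    rw [hA, hB, ← Real.rpow_natCast, ← Real.rpow_mul hn0.le, ← Real.rpow_add hn0,
      ← Real.rpow_natCast]
    congr 1
    push_cast
    ring
  have hkn : (k : ℝ) ≤ n / 2 := hk2.trans hhalf
  have hkn' : k ≤ n := by
    have : (k : ℝ) ≤ n := by linarith
    exact_mod_cast this
  obtain ⟨m, hm⟩ := Nat.exists_eq_add_of_le hkn'
  have hmR : (n : ℝ) = k + m := by exact_mod_cast hm
  have hm2 : (n : ℝ) / 2 ≤ m := by linarith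
  have hm1 : 1 ≤ m := by
    have : (1 : ℝ) ≤ m := by linarith
    exact_mod_cast this
  have hAB : 0 < A * B := by positivity
  have hM : ((k * N + 1 : ℕ) : ℝ) ≤ 3 * (A * B) := by
    have h1 : (k : ℝ) * N ≤ 2 * A * B := by gcongr
    have h2 : 1 ≤ A * B := one_le_mul_of_one_le_of_one_le (by linarith) (by linarith)
    push_cast
    linarith
  have hAsq : A * B ≤ (n : ℝ) ^ 2 := by
    rw [← hABn]
    gcongr
    exact le_self_pow₀ (by linarith) (by norm_num)
  have hlM : (m : ℝ) / 4 ≤ (k * N + 1 : ℕ) := by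
    have h1 : (1 : ℝ) ≤ k := by linarith
    have h2 : (N : ℝ) ≤ k * N := le_mul_of_one_le_left (by positivity) h1
    push_cast
    linarith
  have hQ : 4 * (k * N + 1) ≤ 2 ^ k := by
    have h1 : (n : ℝ) ^ 3 ≤ 2 ^ k := by
      rw [← Real.log_le_log_iff (by positivity) (by positivity), Real.log_pow, Real.log_pow]
      have := Real.log_two_gt_d9
      push_cast
      nlinarith
    have h2 : (4 : ℝ) * (k * N + 1 : ℕ) ≤ 2 ^ k := by nlinarith [sq_nonneg (n : ℝ)]
    exact_mod_cast h2
  have hN2 : Real.log (N + 1) ≤ 3 * Real.log n := by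
    rw [← Nat.cast_ofNat, ← Real.log_pow]
    refine Real.log_le_log (by positivity) ?_
    have : B ≤ A * B := le_mul_of_one_le_left (by positivity) (by linarith)
    nlinarith [sq_nonneg (n : ℝ)]
  have hL : Real.log (((N : ℝ) + 1) ^ k) + Real.log 4
      ≤ ((m : ℝ) / 4) ^ 2 / (8 * (k * N + 1 : ℕ)) := by
    have h1 : A ^ 2 / 1536 ≤ ((m : ℝ) / 4) ^ 2 / (8 * (k * N + 1 : ℕ)) := by
      calc A ^ 2 / 1536 = ((n : ℝ) / 2 / 4) ^ 2 / (8 * (3 * (A * B))) := by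
            have : ((n : ℝ) / 2 / 4) ^ 2 = A ^ 3 * B / 64 := by rw [hABn]; ring
            rw [this]
            have hB0 : B ≠ 0 := by linarith
            field_simp
            norm_num
        _ ≤ _ := by gcongr
    have h2 : Real.log 4 ≤ 3 := by
      linarith [Real.log_le_sub_one_of_pos (show (0 : ℝ) < 4 by norm_num)]
    have h3 : (k : ℝ) * Real.log (N + 1) ≤ 2 * A * (3 * (A / 20000)) := by
      have := Real.log_nonneg (show (1 : ℝ) ≤ N + 1 by simp)
      gcongr
      linarith
    rw [Real.log_pow]
    nlinarith
  have hweight := weight_lt hm1 (Nat.succ_pos (k * N)) (pow_pos (by positivity) k) rfl hlM hQ hL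
  obtain ⟨X, hXm, hX⟩ := exists_family_not_injOn k N m
    (t := (m : ℝ) / 4 / (2 ^ k : ℕ)) (by positivity) (by simpa using hweight)
  obtain ⟨G, hG⟩ := exists_graph_of_family ((finCongr hm).trans finSumFinEquiv.symm) hXm hX
  exact ⟨G, fun ⟨f, hf, hfN⟩ => hG ⟨f, hf, fun v => Nat.le_floor (hfN v)⟩⟩
end

section
/- Let G be a nonempty graph on n vertices with maximum degree Δ, minimum degree δ, and let n' be the largest size of a set of vertices of G whose closed neighborhoods are pairwise distinct. Then s*(G) ≥ (n' + δ)/(Δ + 1). -/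
/-- `sStar G` is the smallest `N` such that `G` has a vertex sum-distinguishing labeling with
all labels at most `N`. -/
noncomputable def sStar {V : Type*} [Fintype V] (G : SimpleGraph V) : ℕ :=
  sInf {N | ∃ f : V → ℕ, VertexSumDistinguishing G f ∧ ∀ v, f v ≤ N}

open Classical in
/-- The degree of a vertex `v` in a graph `G`. -/
noncomputable def degC {V : Type*} [Fintype V] (G : SimpleGraph V) (v : V) : ℕ :=
  (Finset.univ.filter (fun u => G.Adj v u)).card

/-- The maximum degree of a graph `G`. -/
noncomputable def maxDeg {V : Type*} [Fintype V] (G : SimpleGraph V) : ℕ :=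
  Finset.univ.sup (degC G)

/-- The minimum degree of a graph `G`. -/
noncomputable def minDeg {V : Type*} [Fintype V] (G : SimpleGraph V) : ℕ :=
  sInf {k | ∃ v, degC G v = k}

theorem card_closedNbr {V : Type*} [Fintype V] (G : SimpleGraph V) (v : V) :
    (closedNbr G v).card = degC G v + 1 := by
  classical
  have h : closedNbr G v = insert v (Finset.univ.filter (fun u => G.Adj v u)) := by
    ext u
    simp [closedNbr, G.adj_comm]
  rw [h, Finset.card_insert_of_notMem (by simp)]
  simp only [degC]

theorem degC_le_maxDeg {V : Type*} [Fintype V] (G : SimpleGraph V) (v : V) :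
    degC G v ≤ maxDeg G :=
  Finset.le_sup (Finset.mem_univ v)

theorem minDeg_le_degC {V : Type*} [Fintype V] (G : SimpleGraph V) (v : V) :
    minDeg G ≤ degC G v :=
  Nat.sInf_le ⟨v, rfl⟩

/-- Labeling the vertices by distinct powers of two is vertex sum-distinguishing. -/
theorem vertexSumDistinguishing_two_pow {n : ℕ} (G : SimpleGraph (Fin n)) :
    VertexSumDistinguishing G (fun v => 2 ^ (v : ℕ)) := by
  refine ⟨fun v => Nat.one_le_two_pow, fun u v huv h => huv ?_⟩
  apply Finset.map_injective Fin.valEmbedding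
  apply Finset.geomSum_injective le_rfl
  simpa [Finset.sum_map] using h

/-- The labels of some vertex sum-distinguishing labeling are all at most `sStar G`. -/
theorem exists_vertexSumDistinguishing_le_sStar {n : ℕ} (G : SimpleGraph (Fin n)) :
    ∃ f : Fin n → ℕ, VertexSumDistinguishing G f ∧ ∀ v, f v ≤ sStar G :=
  Nat.sInf_mem (s := {N | ∃ f : Fin n → ℕ, VertexSumDistinguishing G f ∧ ∀ v, f v ≤ N})
    ⟨2 ^ n, _, vertexSumDistinguishing_two_pow G,
      fun v => Nat.pow_le_pow_right two_pos v.isLt.le⟩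

theorem minDeg_add_one_le_sum_closedNbr {V : Type*} [Fintype V] (G : SimpleGraph V)
    {f : V → ℕ} (hf : ∀ v, 1 ≤ f v) (v : V) :
    minDeg G + 1 ≤ ∑ x ∈ closedNbr G v, f x := by
  calc minDeg G + 1 ≤ (closedNbr G v).card • 1 := by
        simpa [card_closedNbr] using minDeg_le_degC G v
    _ ≤ _ := Finset.card_nsmul_le_sum _ _ _ fun x _ => hf x

theorem sum_closedNbr_le {V : Type*} [Fintype V] (G : SimpleGraph V)
    {f : V → ℕ} {N : ℕ} (hf : ∀ v, f v ≤ N) (v : V) :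
    ∑ x ∈ closedNbr G v, f x ≤ (maxDeg G + 1) * N := by
  calc _ ≤ (closedNbr G v).card • N := Finset.sum_le_card_nsmul _ _ _ fun x _ => hf x
    _ ≤ _ := by
        rw [card_closedNbr, smul_eq_mul]
        gcongr
        exact degC_le_maxDeg G v

/-- Vertices with pairwise distinct closed neighborhoods have distinct sums in the interval
from `minDeg G + 1` to `(maxDeg G + 1) * N`. -/
theorem card_add_minDeg_le {V : Type*} [Fintype V] [Nonempty V] (G : SimpleGraph V)
    {f : V → ℕ} {N : ℕ} (hf : VertexSumDistinguishing G f) (hN : ∀ v, f v ≤ N) (S : Finset V)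
    (hS : ∀ u ∈ S, ∀ v ∈ S, u ≠ v → closedNbr G u ≠ closedNbr G v) :
    S.card + minDeg G ≤ (maxDeg G + 1) * N := by
  have hcard : S.card ≤ (Finset.Icc (minDeg G + 1) ((maxDeg G + 1) * N)).card := by
    refine Finset.card_le_card_of_injOn (fun v => ∑ x ∈ closedNbr G v, f x) ?_ ?_
    · exact fun v _ => Finset.mem_coe.2 (Finset.mem_Icc.2
        ⟨minDeg_add_one_le_sum_closedNbr G hf.1 v, sum_closedNbr_le G hN v⟩)
    · intro u hu v hv huv
      by_contra hne
      exact hf.2 u v (hS u hu v hv hne) huv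
  rw [Nat.card_Icc] at hcard
  obtain ⟨v⟩ := ‹Nonempty V›
  have := (minDeg_add_one_le_sum_closedNbr G hf.1 v).trans (sum_closedNbr_le G hN v)
  omega

/-- Let `G` be a nonempty graph on `n` vertices with maximum degree `Δ`, minimum degree `δ`,
and let `n'` be the largest size of a set of vertices of `G` whose closed neighborhoods are
pairwise distinct. Then `s*(G) ≥ (n' + δ)/(Δ + 1)`. -/
theorem stmt7 (n : ℕ) (G : SimpleGraph (Fin n)) (hG : G.edgeSet.Nonempty)
    (n' : ℕ)
    (hn' : n' = sSup {k | ∃ S : Finset (Fin n), S.card = k ∧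
      ∀ u ∈ S, ∀ v ∈ S, u ≠ v → closedNbr G u ≠ closedNbr G v}) :
    ((n' : ℝ) + minDeg G) / ((maxDeg G : ℝ) + 1) ≤ sStar G := by
  obtain ⟨f, hf, hN⟩ := exists_vertexSumDistinguishing_le_sStar G
  have hne : Nonempty (Fin n) := by
    obtain ⟨e, -⟩ := hG
    exact ⟨e.out.1⟩
  have hmem : n' ∈ {k | ∃ S : Finset (Fin n), S.card = k ∧
      ∀ u ∈ S, ∀ v ∈ S, u ≠ v → closedNbr G u ≠ closedNbr G v} := by
    rw [hn']
    refine Nat.sSup_mem ⟨0, ∅, by simp⟩ ⟨n, ?_⟩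
    rintro k ⟨S, rfl, -⟩
    simpa using S.card_le_univ
  obtain ⟨S, rfl, hS⟩ := hmem
  rw [div_le_iff₀ (by positivity), mul_comm]
  exact_mod_cast card_add_minDeg_le G hf hN S hS
end

section
/- Let G be a nonempty graph on n vertices with maximum degree Δ, and let d(v) denote the degree of vertex v. Then s*(G) ≤ max{(n − d(v) − 1)(d(v) + 1) + 2 : v ∈ V(G)} ≤ (Δ + 1)·n; in particular, G admits a vertex sum-distinguishing labeling with all labels at most max_v (n − d(v) − 1)(d(v) + 1) + 2. -/
/-- A finite family of finite sets `A` admits positive weights, with the weight of `v` exceeding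
by at most one the number of ordered pairs of members separated by `v`, such that distinct traces
of members of the family on `S` have distinct total weights. -/
theorem exists_weights_of_trace_ne {ι V : Type*} [Fintype ι] [DecidableEq V]
    (A : ι → Finset V) (S : Finset V) :
    ∃ f : V → ℕ, (∀ v, 1 ≤ f v) ∧
      (∀ v, f v ≤ (Finset.univ.filter (fun i => v ∉ A i)).card *
        (Finset.univ.filter (fun i => v ∈ A i)).card + 1) ∧
      ∀ i j, A i ∩ S ≠ A j ∩ S → ∑ x ∈ A i ∩ S, f x ≠ ∑ x ∈ A j ∩ S, f x := by
  induction S using Finset.induction_on with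
  | empty => exact ⟨fun _ => 1, by simp, by simp, by simp⟩
  | insert a S ha ih =>
    obtain ⟨f, hpos, hle, hf⟩ := ih
    let P := Finset.univ.filter (fun i => a ∉ A i) ×ˢ Finset.univ.filter (fun i => a ∈ A i)
    let B := P.image (fun p => ∑ x ∈ A p.1 ∩ S, f x - ∑ x ∈ A p.2 ∩ S, f x)
    obtain ⟨c, hc, hcB⟩ : ∃ c ∈ Finset.Icc 1 (P.card + 1), c ∉ B := by
      refine Finset.exists_mem_notMem_of_card_lt_card ?_
      have : B.card ≤ P.card := Finset.card_image_le
      simp only [Nat.card_Icc]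
      omega
    rw [Finset.mem_Icc] at hc
    have hcP : P.card = _ := Finset.card_product _ _
    have hsum (i : ι) : ∑ x ∈ A i ∩ S, Function.update f a c x = ∑ x ∈ A i ∩ S, f x :=
      Finset.sum_congr rfl fun x hx => Function.update_of_ne
        (ne_of_mem_of_not_mem (Finset.mem_inter.mp hx).2 ha) _ _
    have hnot (i : ι) : a ∉ A i ∩ S := fun h => ha (Finset.mem_inter.mp h).2
    have havoid (i j : ι) (hi : a ∉ A i) (hj : a ∈ A j) :
        ∑ x ∈ A i ∩ S, f x ≠ c + ∑ x ∈ A j ∩ S, f x := fun h =>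
      hcB (Finset.mem_image.mpr ⟨(i, j), by simp [P, hi, hj], by simp [h]⟩)
    refine ⟨Function.update f a c, fun v => ?_, fun v => ?_, fun i j hij => ?_⟩
    · rcases eq_or_ne v a with rfl | h
      · simpa using hc.1
      · simpa [h] using hpos v
    · rcases eq_or_ne v a with rfl | h
      · simpa [← hcP] using hc.2
      · simpa [h] using hle v
    · by_cases hi : a ∈ A i <;> by_cases hj : a ∈ A j
      · rw [Finset.inter_insert_of_mem hi, Finset.inter_insert_of_mem hj] at hij ⊢
        rw [Finset.sum_insert (hnot i), Finset.sum_insert (hnot j), hsum, hsum]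
        exact fun h => hf i j (fun h' => hij (by rw [h'])) (Nat.add_left_cancel h)
      · rw [Finset.inter_insert_of_mem hi, Finset.inter_insert_of_notMem hj,
          Finset.sum_insert (hnot i), hsum, hsum, Function.update_self]
        exact (havoid j i hj hi).symm
      · rw [Finset.inter_insert_of_notMem hi, Finset.inter_insert_of_mem hj,
          Finset.sum_insert (hnot j), hsum, hsum, Function.update_self]
        exact havoid i j hi hj
      · rw [Finset.inter_insert_of_notMem hi, Finset.inter_insert_of_notMem hj] at hij ⊢
        rw [hsum, hsum]
        exact hf i j hij

theorem mem_closedNbr {V : Type*} [Fintype V] {G : SimpleGraph V} {u v : V} :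
    u ∈ closedNbr G v ↔ u = v ∨ G.Adj u v := by
  simp [closedNbr]

open Classical in
theorem card_filter_mem_closedNbr {V : Type*} [Fintype V] (G : SimpleGraph V) (v : V) :
    (Finset.univ.filter (fun u => v ∈ closedNbr G u)).card = degC G v + 1 := by
  rw [degC, ← Finset.card_insert_of_notMem (a := v) (by simp)]
  congr 1
  ext u
  simp [mem_closedNbr, eq_comm]

open Classical in
theorem card_filter_notMem_closedNbr {V : Type*} [Fintype V] (G : SimpleGraph V) (v : V) :
    (Finset.univ.filter (fun u => v ∉ closedNbr G u)).card = Fintype.card V - degC G v - 1 := by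
  have h := Finset.card_filter_add_card_filter_not (s := Finset.univ)
    (fun u => v ∈ closedNbr G u)
  rw [card_filter_mem_closedNbr, Finset.card_univ] at h
  omega

theorem degC_lt_card {V : Type*} [Fintype V] (G : SimpleGraph V) (v : V) :
    degC G v < Fintype.card V := by
  classical
  have h := Finset.card_le_univ (Finset.univ.filter (fun u => v ∈ closedNbr G u))
  rw [card_filter_mem_closedNbr] at h
  omega

theorem one_le_maxDeg {V : Type*} [Fintype V] {G : SimpleGraph V} (hG : G.edgeSet.Nonempty) :
    1 ≤ maxDeg G := by
  obtain ⟨e, he⟩ := hG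
  induction e with
  | _ u v =>
    refine le_trans (Finset.card_pos.mpr ⟨v, ?_⟩) (degC_le_maxDeg G u)
    simpa using he

theorem exists_vertexSumDistinguishing {V : Type*} [Fintype V] (G : SimpleGraph V) :
    ∃ f : V → ℕ, VertexSumDistinguishing G f ∧
      ∀ v, f v ≤ (Fintype.card V - degC G v - 1) * (degC G v + 1) + 1 := by
  classical
  obtain ⟨f, hpos, hle, hf⟩ := exists_weights_of_trace_ne (closedNbr G) Finset.univ
  simp only [Finset.inter_univ] at hf
  refine ⟨f, ⟨hpos, hf⟩, fun v => ?_⟩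
  rw [← card_filter_notMem_closedNbr, ← card_filter_mem_closedNbr]
  exact hle v

/-- Let `G` be a nonempty graph on `n` vertices with maximum degree `Δ`. Then
`s*(G) ≤ max{(n − d(v) − 1)(d(v) + 1) + 2 : v ∈ V(G)} ≤ (Δ + 1)·n`; in particular `G` admits a
vertex sum-distinguishing labeling with all labels at most the middle quantity. -/
theorem stmt8 (n : ℕ) (G : SimpleGraph (Fin n)) (hG : G.edgeSet.Nonempty) :
    sStar G ≤ Finset.univ.sup (fun v => (n - degC G v - 1) * (degC G v + 1) + 2) ∧
    Finset.univ.sup (fun v => (n - degC G v - 1) * (degC G v + 1) + 2) ≤ (maxDeg G + 1) * n ∧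
    ∃ f : Fin n → ℕ, VertexSumDistinguishing G f ∧
      ∀ v, f v ≤ Finset.univ.sup (fun v => (n - degC G v - 1) * (degC G v + 1) + 2) := by
  have hex : ∃ f : Fin n → ℕ, VertexSumDistinguishing G f ∧
      ∀ v, f v ≤ Finset.univ.sup (fun v => (n - degC G v - 1) * (degC G v + 1) + 2) := by
    obtain ⟨f, hf, hle⟩ := exists_vertexSumDistinguishing G
    rw [Fintype.card_fin] at hle
    exact ⟨f, hf, fun v => ((hle v).trans (Nat.le_succ _)).trans
      (Finset.le_sup (f := fun v => (n - degC G v - 1) * (degC G v + 1) + 2)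
        (Finset.mem_univ v))⟩
  refine ⟨Nat.sInf_le hex, Finset.sup_le fun v _ => ?_, hex⟩
  have hlt := degC_lt_card G v
  rw [Fintype.card_fin] at hlt
  obtain ⟨k, hk⟩ : ∃ k, n = k + (degC G v + 1) := ⟨n - (degC G v + 1), by omega⟩
  have hsub : n - degC G v - 1 = k := by omega
  have hmax := one_le_maxDeg hG
  have hdeg := degC_le_maxDeg G v
  rw [hsub]
  calc k * (degC G v + 1) + 2 ≤ (maxDeg G + 1) * (k + (degC G v + 1)) := by
        nlinarith [Nat.mul_le_mul_left k hdeg, Nat.zero_le (maxDeg G * degC G v)]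
    _ = (maxDeg G + 1) * n := by rw [← hk]
end

section
/- Every nonempty graph G on n vertices satisfies s*(G) ≤ n²/4 + 2. -/
/-- Any family of `n` sets can be distinguished, after restriction to a finite set `S`, by the sums
of a positive labeling bounded by `n ^ 2 / 4 + 1`. -/
theorem exists_sum_distinguishing_labeling {ι V : Type*} [Fintype ι] [DecidableEq V]
    (A : ι → Finset V) (S : Finset V) :
    ∃ f : V → ℕ, (∀ v, 1 ≤ f v ∧ f v ≤ Fintype.card ι ^ 2 / 4 + 1) ∧
      ∀ u v, S ∩ A u ≠ S ∩ A v → ∑ x ∈ S ∩ A u, f x ≠ ∑ x ∈ S ∩ A v, f x := by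
  induction S using Finset.induction_on with
  | empty => exact ⟨fun _ => 1, by simp, by simp⟩
  | insert a S ha ih =>
    obtain ⟨f, hf, hS⟩ := ih
    let s : ι → ℕ := fun u => ∑ x ∈ S ∩ A u, f x
    let P : Finset ι := {u | a ∈ A u}
    let Q : Finset ι := {u | a ∉ A u}
    let B : Finset ℕ := (P ×ˢ Q).image fun p => s p.2 - s p.1
    have hB : B.card < (Finset.Icc 1 (Fintype.card ι ^ 2 / 4 + 1)).card := by
      have hPQ : P.card + Q.card = Fintype.card ι :=
        Finset.card_filter_add_card_filter_not (s := Finset.univ) (fun u => a ∈ A u)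
      have hle : B.card ≤ P.card * Q.card := Finset.card_image_le.trans_eq (Finset.card_product _ _)
      have hsq : P.card * Q.card ≤ Fintype.card ι ^ 2 / 4 := by
        rw [Nat.le_div_iff_mul_le (by norm_num), ← hPQ]
        zify
        nlinarith [sq_nonneg ((P.card : ℤ) - Q.card)]
      rw [Nat.card_Icc]
      omega
    obtain ⟨c, hc, hcB⟩ := Finset.exists_mem_notMem_of_card_lt_card hB
    have hsum : ∀ u, ∑ x ∈ insert a S ∩ A u, Function.update f a c x =
        (if a ∈ A u then c else 0) + s u := by
      intro u
      have hS' : ∑ x ∈ S ∩ A u, Function.update f a c x = s u :=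
        Finset.sum_congr rfl fun x hx =>
          Function.update_of_ne (ne_of_mem_of_not_mem (Finset.mem_inter.1 hx).1 ha) _ _
      split_ifs with h
      · rw [Finset.insert_inter_of_mem h, Finset.sum_insert (by simp [ha]), hS']
        simp
      · rw [Finset.insert_inter_of_notMem h, hS', zero_add]
    have hne : ∀ u v, a ∈ A u → a ∉ A v → c + s u ≠ s v := by
      intro u v hu hv h
      refine hcB (Finset.mem_image.2 ⟨(u, v), ?_, ?_⟩)
      · simp [P, Q, hu, hv]
      · change s v - s u = c
        omega
    refine ⟨Function.update f a c, fun v => ?_, fun u v huv => ?_⟩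
    · by_cases h : v = a
      · subst h
        simpa using hc
      · simpa [h] using hf v
    · rw [hsum, hsum]
      by_cases hu : a ∈ A u <;> by_cases hv : a ∈ A v
      · rw [Finset.insert_inter_of_mem hu, Finset.insert_inter_of_mem hv] at huv
        simpa [hu, hv] using hS u v fun h => huv (by rw [h])
      · simpa [hu, hv] using hne u v hu hv
      · simpa [hu, hv] using (hne v u hv hu).symm
      · rw [Finset.insert_inter_of_notMem hu, Finset.insert_inter_of_notMem hv] at huv
        simpa [hu, hv] using hS u v huv

theorem sStar_le {V : Type*} [Fintype V] (G : SimpleGraph V) :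
    sStar G ≤ Fintype.card V ^ 2 / 4 + 1 := by
  classical
  obtain ⟨f, hf, hdist⟩ := exists_sum_distinguishing_labeling (closedNbr G) Finset.univ
  simp only [Finset.univ_inter] at hdist
  exact Nat.sInf_le ⟨f, ⟨fun v => (hf v).1, hdist⟩, fun v => (hf v).2⟩

/-- Every nonempty graph `G` on `n` vertices satisfies `s*(G) ≤ n²/4 + 2`. -/
theorem stmt9 (n : ℕ) (G : SimpleGraph (Fin n)) (hG : G.edgeSet.Nonempty) :
    (sStar G : ℝ) ≤ (n : ℝ) ^ 2 / 4 + 2 := by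
  have h : (sStar G : ℝ) ≤ ((n ^ 2 / 4 : ℕ) : ℝ) + 1 := by
    exact_mod_cast Fintype.card_fin n ▸ sStar_le G
  have hdiv : ((n ^ 2 / 4 : ℕ) : ℝ) ≤ (n : ℝ) ^ 2 / 4 := by
    exact_mod_cast Nat.cast_div_le (α := ℝ) (m := n ^ 2) (n := 4)
  linarith
end

section
/- Let T be a tree on n ≥ 3 vertices. Then s*(T) ≤ 2n − 2 − L(T), where L(T) = max{|L(u)| : u ∈ V(T)} and L(u) denotes the set of leaves adjacent to u; that is, T admits a vertex sum-distinguishing labeling with all labels at most 2n − 2 − L(T). -/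
open Classical in
/-- `leafNbrCount G u` is the number of leaves (vertices of degree 1) adjacent to `u`. -/
noncomputable def leafNbrCount {V : Type*} [Fintype V] (G : SimpleGraph V) (u : V) : ℕ :=
  (Finset.univ.filter (fun w => G.Adj u w ∧ degC G w = 1)).card

/-- `LT G` is the maximum, over vertices `u`, of the number of leaves adjacent to `u`. -/
noncomputable def LTmax {V : Type*} [Fintype V] (G : SimpleGraph V) : ℕ :=
  Finset.univ.sup (leafNbrCount G)

/-- Greedy labeling along an injective rank `r`: if `e a` is the element of `N a` of largest rank and
each vertex is the last one for fewer than `M` of the pairs in `R`, then labels in `[1, M]` can be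
chosen so that the sums over `N a` and `N b` differ for every `(a, b) ∈ R`. -/
theorem exists_greedy_labeling {V : Type*} [DecidableEq V] (N : V → Finset V) (r : V → ℕ)
    (hr : Function.Injective r) (e : V → V) (he : ∀ a, e a ∈ N a)
    (hmax : ∀ a, ∀ y ∈ N a, r y ≤ r (e a)) (R : Finset (V × V))
    (hR : ∀ q ∈ R, r (e q.2) < r (e q.1)) (M : ℕ)
    (hM : ∀ x, (R.filter (fun q => e q.1 = x)).card < M) :
    ∃ f : V → ℕ, (∀ v, 1 ≤ f v ∧ f v ≤ M) ∧
      ∀ q ∈ R, ∑ x ∈ N q.1, f x ≠ ∑ x ∈ N q.2, f x := by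
  have key : ∀ k : ℕ, ∃ f : V → ℕ, (∀ v, 1 ≤ f v ∧ f v ≤ M) ∧
      ∀ q ∈ R, r (e q.1) < k → ∑ x ∈ N q.1, f x ≠ ∑ x ∈ N q.2, f x := by
    intro k
    induction k with
    | zero =>
      refine ⟨fun _ => 1, fun v => ⟨le_rfl, ?_⟩, fun q _ h => absurd h (Nat.not_lt_zero _)⟩
      exact Nat.one_le_iff_ne_zero.mpr (Nat.ne_zero_of_lt (hM v))
    | succ k ih =>
      obtain ⟨f, hf, hfR⟩ := ih
      by_cases hx : ∃ x, r x = k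
      · obtain ⟨x, rfl⟩ := hx
        have hnot : ∀ a, r (e a) < r x → x ∉ N a := fun a ha hxa =>
          absurd (hmax a x hxa) (not_le.mpr ha)
        have hupd : ∀ (m : ℕ) (s : Finset V), x ∉ s →
            ∑ y ∈ s, Function.update f x m y = ∑ y ∈ s, f y := by
          intro m s hs
          refine Finset.sum_congr rfl fun y hy => Function.update_of_ne ?_ _ _
          rintro rfl
          exact hs hy
        obtain ⟨m, hm, hmF⟩ : ∃ m ∈ Finset.Icc 1 M,
            m ∉ (R.filter (fun q => e q.1 = x)).image
              (fun q => ∑ y ∈ N q.2, f y - ∑ y ∈ (N q.1).erase x, f y) := by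
          refine Finset.exists_mem_notMem_of_card_lt_card
            (Finset.card_image_le.trans_lt ?_)
          simpa using hM x
        refine ⟨Function.update f x m, fun v => ?_, fun q hq hqk => ?_⟩
        · rcases eq_or_ne v x with rfl | hv
          · simpa using hm
          · simpa [Function.update_of_ne hv] using hf v
        · rcases (Nat.lt_succ_iff.mp hqk).lt_or_eq with h | h
          · rw [hupd m _ (hnot _ h), hupd m _ (hnot _ ((hR q hq).trans h))]
            exact hfR q hq h
          · have hex : e q.1 = x := hr h
            rw [hupd m _ (hnot _ ((hR q hq).trans_eq h)),
              ← Finset.add_sum_erase (N q.1) (Function.update f x m) (hex ▸ he q.1 : x ∈ N q.1),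
              hupd m _ (Finset.notMem_erase x _), Function.update_self]
            intro h2
            refine hmF (Finset.mem_image.mpr ⟨q, Finset.mem_filter.mpr ⟨hq, hex⟩, ?_⟩)
            omega
      · refine ⟨f, hf, fun q hq hqk => hfR q hq ?_⟩
        exact lt_of_le_of_ne (Nat.lt_succ_iff.mp hqk) fun h => hx ⟨_, h⟩
  obtain ⟨f, hf, hfR⟩ := key (R.sup (fun q => r (e q.1)) + 1)
  exact ⟨f, hf, fun q hq => hfR q hq
    (Nat.lt_succ_of_le (Finset.le_sup (f := fun q : V × V => r (e q.1)) hq))⟩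

/-- In a tree, a vertex has at most one neighbor that is not farther from a given root. -/
theorem SimpleGraph.IsTree.exists_parent {V : Type*} {G : SimpleGraph V} (hG : G.IsTree)
    (u x : V) : ∃ p, ∀ a, G.Adj a x → G.dist u a ≤ G.dist u x → a = p := by
  classical
  obtain ⟨P, hP, -⟩ := hG.connected.exists_path_of_dist u x
  refine ⟨P.penultimate, fun a hax hd => ?_⟩
  obtain ⟨Q, hQ, hQd⟩ := hG.connected.exists_path_of_dist u a
  have hxQ : x ∉ Q.support := by
    intro hx
    have h1 := SimpleGraph.Walk.length_takeUntil_lt_length hx hax.ne'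
    have h2 := SimpleGraph.dist_le (Q.takeUntil x hx)
    omega
  have hPQ : P = Q.concat hax := by
    have := hG.isAcyclic.subsingleton_path u x
    exact congrArg Subtype.val
      (Subsingleton.elim (⟨P, hP⟩ : G.Path u x) ⟨Q.concat hax, hQ.concat hxQ hax⟩)
  rw [hPQ, SimpleGraph.Walk.penultimate_concat]

/-- If the root `u` of a finite tree is adjacent to at least one leaf, the vertices can be ranked
injectively so that each vertex has at most one neighbor of smaller rank and the leaves at `u`
are ranked above all other vertices. -/
theorem SimpleGraph.IsTree.exists_rank {n : ℕ} {T : SimpleGraph (Fin n)} (hT : T.IsTree)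
    (u : Fin n) (A : Finset (Fin n)) (hA : ∀ w ∈ A, ∀ y, T.Adj y w ↔ y = u) :
    ∃ (r : Fin n → ℕ) (p : Fin n → Fin n), Function.Injective r ∧
      (∀ x a, T.Adj a x → r a < r x → a = p x) ∧ ∀ w ∈ A, ∀ y, y ∉ A → r y < r w := by
  choose p hp using hT.exists_parent u
  set D := ∑ v, T.dist u v + 1
  have hlt : ∀ v, T.dist u v < D := fun v =>
    Nat.lt_succ_of_le (Finset.single_le_sum (f := fun v => T.dist u v)
      (fun _ _ => Nat.zero_le _) (Finset.mem_univ v))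
  set k : Fin n → ℕ := fun v => if v ∈ A then D else T.dist u v with hk
  have hmono : ∀ a b, k a < k b → k a * n + a < k b * n + b := by
    intro a b h
    have h1 : (k a + 1) * n ≤ k b * n := Nat.mul_le_mul_right n h
    have h2 := a.isLt
    rw [add_mul] at h1
    omega
  have hu : u ∉ A := fun h => T.loopless.irrefl u ((hA u h u).mpr rfl)
  have hkA : ∀ w ∈ A, ∀ y, y ∉ A → k y < k w := by
    intro w hw y hy
    simpa [hk, hw, hy] using hlt y
  refine ⟨fun v => k v * n + v, p, ?_, ?_, fun w hw y hy => hmono _ _ (hkA w hw y hy)⟩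
  · intro a b h
    rcases lt_trichotomy (k a) (k b) with h1 | h1 | h1
    · exact absurd h (hmono _ _ h1).ne
    · simp only [h1] at h
      exact Fin.ext (by omega)
    · exact absurd h (hmono _ _ h1).ne'
  · intro x a hax hr
    by_cases hxA : x ∈ A
    · have := (hA x hxA a).mp hax
      subst this
      exact hp x a hax (by simp)
    · by_cases haA : a ∈ A
      · exact absurd (hmono _ _ (hkA a haA x hxA)) (not_lt.mpr hr.le)
      · refine hp x a hax ?_
        by_contra! hd
        exact absurd (hmono x a (by simpa [hk, hxA, haA] using hd)) (not_lt.mpr hr.le)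

theorem sum_closedNbr_lt {V : Type*} [Fintype V] {G : SimpleGraph V} {f : V → ℕ}
    (hf : ∀ v, 1 ≤ f v) {a b : V} (hsub : closedNbr G a ⊆ closedNbr G b)
    (hne : closedNbr G a ≠ closedNbr G b) :
    ∑ x ∈ closedNbr G a, f x < ∑ x ∈ closedNbr G b, f x := by
  obtain ⟨y, hyb, hya⟩ := Finset.exists_of_ssubset (hsub.ssubset_of_ne hne)
  exact Finset.sum_lt_sum_of_subset hsub hyb hya (hf y) fun _ _ _ => Nat.zero_le _

/-- If the vertices in `A` are leaves attached to `u`, the tree has a vertex sum-distinguishing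
labeling with labels at most `2n - 2 - |A|`. -/
theorem SimpleGraph.IsTree.exists_vertexSumDistinguishing {n : ℕ} {T : SimpleGraph (Fin n)}
    (hT : T.IsTree) (u : Fin n) (A : Finset (Fin n)) (hA : ∀ w ∈ A, ∀ y, T.Adj y w ↔ y = u)
    (hne : A.Nonempty) :
    ∃ f : Fin n → ℕ, VertexSumDistinguishing T f ∧ ∀ v, f v ≤ 2 * n - 2 - A.card := by
  obtain ⟨r, p, hr, hp, hrA⟩ := hT.exists_rank u A hA
  have hu : u ∉ A := fun h => T.loopless.irrefl u ((hA u h u).mpr rfl)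
  have hself : ∀ a, a ∈ closedNbr T a := fun a => mem_closedNbr.mpr (.inl rfl)
  choose e he hmax using fun a => Finset.exists_max_image (closedNbr T a) r ⟨a, hself a⟩
  have hea : ∀ a, a = e a ∨ a = p (e a) := by
    intro a
    rcases mem_closedNbr.mp (he a) with h | h
    · exact .inl h.symm
    · exact .inr (hp _ _ h.symm ((hmax a a (hself a)).lt_of_ne (hr.ne h.ne')))
  have hrself : ∀ a, r a ≤ r (e a) := fun a => hmax a a (hself a)
  have hru : ∀ w ∈ A, r w ≤ r (e u) := fun w hw =>
    hmax u w (mem_closedNbr.mpr (.inr ((hA w hw u).mpr rfl).symm))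
  set R : Finset (Fin n × Fin n) := Finset.univ.filter
    (fun q => r (e q.2) < r (e q.1) ∧ ¬ (q.1 = u ∧ q.2 ∈ A)) with hRdef
  have hcard : (insert u A).card = A.card + 1 := Finset.card_insert_of_notMem hu
  have hcardn : (insert u A).card ≤ n := by simpa using Finset.card_le_univ (insert u A)
  have hApos := hne.card_pos
  have hcompl : (insert u A)ᶜ.card = n - (A.card + 1) := by
    rw [Finset.card_compl, hcard, Fintype.card_fin]
  have hcount : ∀ x, (R.filter (fun q => e q.1 = x)).card < 2 * n - 2 - A.card := by
    intro x
    by_cases hx : x ∈ A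
    · have hxu : x ≠ u := fun h => hu (h ▸ hx)
      have hpx : u = p x := hp x u ((hA x hx u).mpr rfl) (hrA x hx u hu)
      have hsub : R.filter (fun q => e q.1 = x) ⊆
          ({x} ×ˢ ({x, u} : Finset (Fin n))ᶜ) ∪ ({u} ×ˢ (insert u A)ᶜ) := by
        rintro ⟨a, b⟩ hq
        simp only [hRdef, Finset.mem_filter, Finset.mem_univ, true_and] at hq
        obtain ⟨⟨hlt, hex⟩, rfl⟩ := hq
        have hbu : b ≠ u := by
          rintro rfl
          exact absurd (hru _ hx) (not_le.mpr hlt)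
        have hbx : b ≠ e a := by
          rintro rfl
          exact absurd (hrself (e a)) (not_le.mpr hlt)
        rcases hea a with h | h
        · rw [← h] at hbx ⊢
          simp [hbu, hbx]
        · have hau : a = u := h.trans hpx.symm
          simp [hau, hbu, show b ∉ A from fun hb => hex ⟨hau, hb⟩]
      refine (Finset.card_le_card hsub).trans_lt ((Finset.card_union_le _ _).trans_lt ?_)
      rw [Finset.card_product, Finset.card_product, Finset.card_singleton, Finset.card_singleton,
        hcompl, Finset.card_compl, Finset.card_pair hxu, Fintype.card_fin]
      omega
    · have hsub : R.filter (fun q => e q.1 = x) ⊆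
          ({x, p x} : Finset (Fin n)) ×ˢ (insert u A)ᶜ := by
        rintro ⟨a, b⟩ hq
        simp only [hRdef, Finset.mem_filter, Finset.mem_univ, true_and] at hq
        obtain ⟨⟨hlt, -⟩, rfl⟩ := hq
        simp only [Finset.mem_product, Finset.mem_insert, Finset.mem_singleton, Finset.mem_compl]
        refine ⟨hea a, ?_⟩
        rintro (rfl | hb)
        · obtain ⟨w, hw⟩ := hne
          exact absurd hlt (not_lt.mpr ((hrA w hw _ hx).le.trans (hru w hw)))
        · exact absurd hlt (not_lt.mpr ((hrA b hb _ hx).le.trans (hrself b)))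
      refine (Finset.card_le_card hsub).trans_lt ?_
      rw [Finset.card_product, hcompl]
      have : ({x, p x} : Finset (Fin n)).card * (n - (A.card + 1)) ≤ 2 * (n - (A.card + 1)) :=
        Nat.mul_le_mul_right _ Finset.card_le_two
      omega
  obtain ⟨f, hf, hfR⟩ := exists_greedy_labeling (closedNbr T) r hr e he hmax R
    (fun q hq => (Finset.mem_filter.mp hq).2.1) _ hcount
  have hpos : ∀ v, 1 ≤ f v := fun v => (hf v).1
  have hsubset : ∀ a b, a = e a → b = p (e a) → e a = e b →
      closedNbr T a ⊆ closedNbr T b := by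
    intro a b ha hb hab y hy
    rcases mem_closedNbr.mp hy with h | h
    · rw [h, ha, hab]
      exact he b
    · have hya : r y < r a := by
        refine lt_of_le_of_ne ?_ (hr.ne h.ne)
        conv_rhs => rw [ha]
        exact hmax a y hy
      rw [hp a y h hya, ← show b = p a by rw [hb, ← ha]]
      exact hself b
  have hlt : ∀ a b, r (e b) < r (e a) → closedNbr T a ≠ closedNbr T b →
      ∑ x ∈ closedNbr T a, f x ≠ ∑ x ∈ closedNbr T b, f x := by
    intro a b hab hN
    by_cases h : a = u ∧ b ∈ A
    · obtain ⟨rfl, hb⟩ := h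
      refine (sum_closedNbr_lt hpos (fun y hy => ?_) hN.symm).ne'
      rcases mem_closedNbr.mp hy with rfl | h
      · exact mem_closedNbr.mpr (.inr ((hA _ hb a).mpr rfl).symm)
      · rw [(hA b hb y).mp h]
        exact hself a
    · exact hfR (a, b) (by simp [hRdef, hab]; tauto)
  refine ⟨f, ⟨hpos, fun a b hN => ?_⟩, fun v => (hf v).2⟩
  rcases lt_trichotomy (r (e a)) (r (e b)) with h | h | h
  · exact (hlt b a h hN.symm).symm
  · have hab := hr h
    rcases hea a with ha | ha <;> rcases hea b with hb | hb
    · exact absurd (by rw [ha, hb, hab]) hN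
    · exact (sum_closedNbr_lt hpos (hsubset a b ha (hab ▸ hb) hab) hN).ne
    · exact (sum_closedNbr_lt hpos (hsubset b a hb (hab ▸ ha) hab.symm) hN.symm).ne'
    · exact absurd (by rw [ha, hb, hab]) hN
  · exact hlt a b h hN

/-- A vertex of degree one adjacent to `u` has no other neighbor. -/
theorem adj_iff_of_degC_eq_one {V : Type*} [Fintype V] {G : SimpleGraph V} {u w : V}
    (h : G.Adj u w) (hw : degC G w = 1) (y : V) : G.Adj y w ↔ y = u := by
  obtain ⟨z, hz⟩ := Finset.card_eq_one.mp hw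
  have hmem : ∀ y, G.Adj w y ↔ y = z := by
    intro y
    simpa using Finset.ext_iff.mp hz y
  rw [G.adj_comm, hmem, (hmem u).mp h.symm]

/-- A nontrivial finite tree has a vertex adjacent to a leaf. -/
theorem SimpleGraph.IsTree.LTmax_pos {V : Type*} [Fintype V] [Nontrivial V] {G : SimpleGraph V}
    (hG : G.IsTree) : 0 < LTmax G := by
  classical
  obtain ⟨w, hw⟩ := hG.exists_vert_degree_one_of_nontrivial
  have hw' : degC G w = 1 := by
    rw [← hw, ← G.card_neighborFinset_eq_degree]
    unfold degC
    congr 1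
    ext y
    simp
  obtain ⟨u, hu⟩ := hG.connected.preconnected.exists_adj_of_nontrivial w
  refine lt_of_lt_of_le ?_ (Finset.le_sup (f := leafNbrCount G) (Finset.mem_univ u))
  exact Finset.card_pos.mpr ⟨w, by simp [hu.symm, hw']⟩

/-- Let `T` be a tree on `n ≥ 3` vertices. Then `s*(T) ≤ 2n − 2 − L(T)`; that is, `T` admits a
vertex sum-distinguishing labeling with all labels at most `2n − 2 − L(T)`. -/
theorem stmt10 (n : ℕ) (hn : 3 ≤ n) (T : SimpleGraph (Fin n)) (hT : T.IsTree) :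
    sStar T ≤ 2 * n - 2 - LTmax T ∧
    ∃ f : Fin n → ℕ, VertexSumDistinguishing T f ∧ ∀ v, f v ≤ 2 * n - 2 - LTmax T := by
  have : Nontrivial (Fin n) := Fin.nontrivial_iff_two_le.mpr (by omega)
  have hpos := hT.LTmax_pos
  have hex : ∃ f : Fin n → ℕ, VertexSumDistinguishing T f ∧
      ∀ v, f v ≤ 2 * n - 2 - LTmax T := by
    obtain ⟨u, -, hu⟩ := Finset.exists_mem_eq_sup Finset.univ Finset.univ_nonempty (leafNbrCount T)
    change LTmax T = leafNbrCount T u at hu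
    rw [hu] at hpos ⊢
    refine hT.exists_vertexSumDistinguishing u _ (fun w hw => ?_) (Finset.card_pos.mp hpos)
    obtain ⟨h, hw1⟩ : T.Adj u w ∧ degC T w = 1 := by simpa using hw
    exact adj_iff_of_degC_eq_one h hw1
  exact ⟨Nat.sInf_le hex, hex⟩
end

section
/- For every n ≥ 3, the star K_{1,n−1} on n vertices satisfies s*(K_{1,n−1}) = n − 1; in particular, every vertex sum-distinguishing labeling of the star uses some label at least n − 1, so the bound s*(T) ≤ 2n − 2 − L(T) is tight for stars. -/
/-- The star `K_{1,n-1}` on vertex set `Fin n`: the vertex `0` is adjacent to all other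
vertices, and there are no other edges. -/
def starGraph (n : ℕ) (hn : 3 ≤ n) : SimpleGraph (Fin n) :=
  SimpleGraph.fromRel (fun u _ => u = (⟨0, by omega⟩ : Fin n))

theorem closedNbr_starGraph_center (n : ℕ) (hn : 3 ≤ n) :
    closedNbr (starGraph n hn) ⟨0, by omega⟩ = Finset.univ := by
  ext u
  simp only [closedNbr, starGraph, SimpleGraph.fromRel_adj, Finset.mem_filter, Finset.mem_univ,
    true_and, iff_true]
  tauto

theorem closedNbr_starGraph_leaf (n : ℕ) (hn : 3 ≤ n) {v : Fin n} (hv : v ≠ ⟨0, by omega⟩) :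
    closedNbr (starGraph n hn) v = {v, ⟨0, by omega⟩} := by
  ext u
  simp only [closedNbr, starGraph, SimpleGraph.fromRel_adj, Finset.mem_filter, Finset.mem_univ,
    true_and, Finset.mem_insert, Finset.mem_singleton]
  grind

theorem sum_closedNbr_starGraph_leaf (n : ℕ) (hn : 3 ≤ n) (f : Fin n → ℕ) {v : Fin n}
    (hv : v ≠ ⟨0, by omega⟩) :
    ∑ x ∈ closedNbr (starGraph n hn) v, f x = f v + f ⟨0, by omega⟩ := by
  rw [closedNbr_starGraph_leaf n hn hv, Finset.sum_pair hv]

theorem sum_closedNbr_starGraph_leaf_lt_center (n : ℕ) (hn : 3 ≤ n) {f : Fin n → ℕ}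
    (hf : ∀ v, 1 ≤ f v) {v : Fin n} (hv : v ≠ ⟨0, by omega⟩) :
    ∑ x ∈ closedNbr (starGraph n hn) v, f x <
      ∑ x ∈ closedNbr (starGraph n hn) ⟨0, by omega⟩, f x := by
  rw [closedNbr_starGraph_center, closedNbr_starGraph_leaf n hn hv]
  obtain ⟨w, hw_univ, hw⟩ := Finset.exists_mem_notMem_of_card_lt_card
    (by rw [Finset.card_fin, Finset.card_pair hv]; omega :
      ({v, ⟨0, _⟩} : Finset (Fin n)).card < (Finset.univ : Finset (Fin n)).card)
  exact Finset.sum_lt_sum_of_subset (Finset.subset_univ _) hw_univ hw (hf w)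
    fun _ _ _ => Nat.zero_le _

/-- A positive labeling of a star is vertex sum-distinguishing exactly when its leaves receive
distinct labels. -/
theorem vertexSumDistinguishing_starGraph_iff (n : ℕ) (hn : 3 ≤ n) (f : Fin n → ℕ) :
    VertexSumDistinguishing (starGraph n hn) f ↔
      (∀ v, 1 ≤ f v) ∧ Set.InjOn f {v | v ≠ ⟨0, by omega⟩} := by
  refine and_congr_right fun hf => ⟨fun h u hu v hv huv => ?_, fun h u v huv => ?_⟩
  · by_contra hne
    refine h u v (fun hN => ?_) ?_
    · rw [closedNbr_starGraph_leaf n hn hu, closedNbr_starGraph_leaf n hn hv] at hN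
      have hmem : u ∈ ({v, ⟨0, by omega⟩} : Finset (Fin n)) :=
        hN ▸ Finset.mem_insert_self _ _
      rw [Finset.mem_insert, Finset.mem_singleton] at hmem
      exact hmem.elim hne hu
    · rw [sum_closedNbr_starGraph_leaf n hn f hu, sum_closedNbr_starGraph_leaf n hn f hv, huv]
  · by_cases hu : u = ⟨0, by omega⟩ <;> by_cases hv : v = ⟨0, by omega⟩
    · exact absurd (by rw [hu, hv]) huv
    · exact hu ▸ (sum_closedNbr_starGraph_leaf_lt_center n hn hf hv).ne'
    · exact hv ▸ (sum_closedNbr_starGraph_leaf_lt_center n hn hf hu).ne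
    · rw [sum_closedNbr_starGraph_leaf n hn f hu, sum_closedNbr_starGraph_leaf n hn f hv]
      intro hsum
      exact huv (congrArg _ (h hu hv (Nat.add_right_cancel hsum)))

theorem VertexSumDistinguishing.exists_le_starGraph (n : ℕ) (hn : 3 ≤ n) {f : Fin n → ℕ}
    (hf : VertexSumDistinguishing (starGraph n hn) f) : ∃ v, n - 1 ≤ f v := by
  obtain ⟨hpos, hinj⟩ := (vertexSumDistinguishing_starGraph_iff n hn f).1 hf
  by_contra! hlt
  have hcard := Finset.card_le_card_of_injOn (s := Finset.univ.erase (⟨0, by omega⟩ : Fin n))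
    (t := Finset.Ico 1 (n - 1)) f (fun v _ => Finset.mem_coe.2 (Finset.mem_Ico.2 ⟨hpos v, hlt v⟩))
    (hinj.mono fun v hv => Finset.ne_of_mem_erase hv)
  rw [Finset.card_erase_of_mem (Finset.mem_univ _), Finset.card_fin, Nat.card_Ico] at hcard
  omega

theorem exists_vertexSumDistinguishing_starGraph_le (n : ℕ) (hn : 3 ≤ n) :
    ∃ f : Fin n → ℕ, VertexSumDistinguishing (starGraph n hn) f ∧ ∀ v, f v ≤ n - 1 := by
  refine ⟨fun v => max 1 v.val, (vertexSumDistinguishing_starGraph_iff n hn _).2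
    ⟨fun v => le_max_left _ _, fun u hu v hv huv => ?_⟩, fun v => ?_⟩
  · simp only [Set.mem_ofPred_eq, ne_eq, Fin.ext_iff] at hu hv huv ⊢
    omega
  · have := v.isLt
    dsimp only
    omega

/-- For every `n ≥ 3`, the star `K_{1,n−1}` on `n` vertices satisfies `s*(K_{1,n−1}) = n − 1`;
in particular every vertex sum-distinguishing labeling of the star uses some label at least
`n − 1`. -/
theorem stmt11 (n : ℕ) (hn : 3 ≤ n) :
    sStar (starGraph n hn) = n - 1 ∧
    ∀ f : Fin n → ℕ, VertexSumDistinguishing (starGraph n hn) f → ∃ v, n - 1 ≤ f v := by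
  refine ⟨IsLeast.csInf_eq ⟨exists_vertexSumDistinguishing_starGraph_le n hn, ?_⟩,
    fun f hf => hf.exists_le_starGraph n hn⟩
  rintro N ⟨f, hf, hN⟩
  obtain ⟨v, hv⟩ := hf.exists_le_starGraph n hn
  exact hv.trans (hN v)
end
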